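/- arXiv:2207.13951 — 6 statements merged into one kernel-verified Lean document; each statement's English description precedes it below -/
import Mathlib

section
/- Let (V,T) be a cubic space over k whose residual rank is infinite (i.e., the image of the map v ↦ class of f_v in P̄₂(V) is an infinite-dimensional subspace). Then every cubic space (W,S) over k with dim_k W ≤ ℵ₀ admits an embedding of cubic spaces W → V. -/
open scoped BigOperators

/-- The submodule of quadratic forms of finite strength: those expressible as a finite
sum of products of two linear forms. -/
def FinStrength (k V : Type*) [Field k] [AddCommGroup V] [Module k V] :
    Submodule k (QuadraticForm k V) where
  carrier := {q | ∃ (n : ℕ) (l m : Fin n → V →ₗ[k] k), ∀ x, q x = ∑ i, l i x * m i x}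
  zero_mem' := ⟨0, ![], ![], fun x => by simp⟩
  add_mem' := by
    rintro q q' ⟨n, l, m, h⟩ ⟨n', l', m', h'⟩
    refine ⟨n + n', Fin.append l l', Fin.append m m', fun x => ?_⟩
    simp [Fin.sum_univ_add, Fin.append_left, Fin.append_right, h, h']
  smul_mem' := by
    rintro c q ⟨n, l, m, h⟩
    refine ⟨n, fun i => c • l i, m, fun x => ?_⟩
    simp [h, Finset.mul_sum, mul_assoc, smul_eq_mul]

/-- For a trilinear form `T` and a vector `v`, the quadratic form `f_v : x ↦ 3 * T v x x`. -/
noncomputable def fQuad {k V : Type*} [Field k] [AddCommGroup V] [Module k V]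
    (T : V →ₗ[k] V →ₗ[k] V →ₗ[k] k) (v : V) : QuadraticForm k V :=
  LinearMap.BilinMap.toQuadraticMap ((3 : k) • T v)

/-- The residual rank of a trilinear form `T`: the dimension of the image of the linear
map `v ↦ class of f_v` in the quotient of the space of quadratic forms by the subspace
of finite-strength quadratic forms. -/
noncomputable def rrk (k : Type*) {V : Type*} [Field k] [AddCommGroup V] [Module k V]
    (T : V →ₗ[k] V →ₗ[k] V →ₗ[k] k) : Cardinal :=
  Module.rank k ↥(Submodule.span k
    (Set.range fun v => Submodule.Quotient.mk (p := FinStrength k V) (fQuad T v)))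

/-- A cubic space `(V,T)` has finite strength if its cubic form `x ↦ T x x x` is a
finite sum of products of a linear form with a quadratic form. -/
def FiniteStrengthCubic (k : Type*) {V : Type*} [Field k] [AddCommGroup V] [Module k V]
    (T : V →ₗ[k] V →ₗ[k] V →ₗ[k] k) : Prop :=
  ∃ (n : ℕ) (l : Fin n → V →ₗ[k] k) (q : Fin n → QuadraticForm k V),
    ∀ x, T x x x = ∑ i, l i x * q i x


section CubicAux

variable {k V : Type*} [Field k] [AddCommGroup V] [Module k V]

/-- If the join of a submodule with a finitely generated one has finite codimension,
so has the submodule itself. -/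
theorem aux_cofg_of_sup {M P : Submodule k V} (hP : P.FG) (h : (M ⊔ P).CoFG) : M.CoFG := by
  obtain ⟨R, hR⟩ := Submodule.exists_isCompl (M ⊔ P)
  have hRfg : R.FG := Submodule.CoFG.fg_of_isCompl hR h
  refine Submodule.FG.cofg_of_codisjoint (S := P ⊔ R) ?_ (hP.sup hRfg)
  rw [codisjoint_iff]
  have := hR.sup_eq_top
  rw [← this]
  ac_rfl

/-- A finite-codimensional subspace is not contained in one of infinite codimension. -/
theorem aux_exists_notMem {U M : Submodule k V} (hU : U.CoFG) (hM : ¬ M.CoFG) :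
    ∃ u ∈ U, u ∉ M := by
  by_contra! h
  exact hM (Submodule.CoFG.of_le h hU)

/-- The vectors orthogonal to a finite-dimensional subspace contain a subspace of finite
codimension. -/
theorem aux_perp (T : V →ₗ[k] V →ₗ[k] V →ₗ[k] k) {G : Submodule k V} (hG : G.FG) :
    ∃ U : Submodule k V, U.CoFG ∧ ∀ u ∈ U, ∀ a ∈ G, ∀ b ∈ G, T a b u = 0 := by
  obtain ⟨s, rfl⟩ := hG
  refine ⟨LinearMap.ker (LinearMap.pi (fun i : s × s => T i.1 i.2)), Submodule.CoFG.ker _, ?_⟩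
  intro u hu a ha b hb
  have h0 : ∀ x ∈ s, ∀ y ∈ s, T x y u = 0 := by
    intro x hx y hy
    have := congrFun (LinearMap.mem_ker.1 hu) (⟨x, hx⟩, ⟨y, hy⟩)
    simpa using this
  induction ha using Submodule.span_induction with
  | mem x hx =>
    induction hb using Submodule.span_induction with
    | mem y hy => exact h0 x hx y hy
    | zero => simp
    | add y z _ _ h1 h2 => simp [h1, h2]
    | smul c y _ h1 => simp [h1]
  | zero => simp
  | add y z _ _ h1 h2 => simp [h1, h2]
  | smul c y _ h1 => simp [h1]

/-- Maximal system of values of quadratic forms on mutually orthogonal vectors. -/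
theorem aux_max [IsAlgClosed k] (T : V →ₗ[k] V →ₗ[k] V →ₗ[k] k)
    (hT2 : ∀ x y z, T x y z = T x z y)
    {ι : Type*} [Fintype ι] (a : ι → V) (U : Submodule k V) (hU : U.CoFG) :
    ∃ (D : Submodule k (ι → k)) (P U' : Submodule k V), P.FG ∧ P ≤ U ∧ U'.CoFG ∧ U' ≤ U ∧
      (∀ d ∈ D, ∃ p ∈ P, ∀ j, T (a j) p p = d j) ∧
      (∀ u ∈ U', ∀ p ∈ P, ∀ j, T (a j) p u = 0) ∧
      (∀ u ∈ U', (fun j => T (a j) u u) ∈ D) := by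
  let good : Set (Submodule k (ι → k)) := {D | ∃ P : Submodule k V, P.FG ∧ P ≤ U ∧
    ∀ d ∈ D, ∃ p ∈ P, ∀ j, T (a j) p p = d j}
  have hne : good.Nonempty := by
    refine ⟨⊥, ⊥, Submodule.fg_bot, bot_le, ?_⟩
    intro d hd
    rw [Submodule.mem_bot] at hd
    exact ⟨0, Submodule.zero_mem _, by simp [hd]⟩
  obtain ⟨D, ⟨P, hPfg, hPU, hD⟩, hmax⟩ :=
    WellFounded.has_min (wellFounded_gt (α := Submodule k (ι → k))) good hne
  obtain ⟨U1, hU1, hperp⟩ := aux_perp T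
    (G := P ⊔ Submodule.span k (Set.range a)) (hPfg.sup (Submodule.fg_span (Set.finite_range a)))
  have horth : ∀ u ∈ U ⊓ U1, ∀ p ∈ P, ∀ j, T (a j) p u = 0 := fun u hu p hp j =>
    hperp u hu.2 _ (Submodule.mem_sup_right (Submodule.subset_span ⟨j, rfl⟩)) _
      (Submodule.mem_sup_left hp)
  refine ⟨D, P, U ⊓ U1, hPfg, hPU, hU.inf hU1, inf_le_left, hD, horth, ?_⟩
  intro u hu
  by_contra hnot
  refine hmax (D ⊔ Submodule.span k {fun j => T (a j) u u}) ?_ ?_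
  · refine ⟨P ⊔ Submodule.span k {u}, hPfg.sup (Submodule.fg_span_singleton u), ?_, ?_⟩
    · rw [sup_le_iff, Submodule.span_singleton_le_iff_mem]
      exact ⟨hPU, hu.1⟩
    · intro d hd
      obtain ⟨d1, hd1, d2, hd2, rfl⟩ := Submodule.mem_sup.1 hd
      obtain ⟨c, rfl⟩ := Submodule.mem_span_singleton.1 hd2
      obtain ⟨p, hp, hpd⟩ := hD d1 hd1
      obtain ⟨s, hs⟩ := IsAlgClosed.exists_pow_nat_eq c (n := 2) (by norm_num)
      refine ⟨p + s • u, Submodule.add_mem_sup hp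
        (Submodule.smul_mem _ _ (Submodule.mem_span_singleton_self u)), ?_⟩
      intro j
      have h1 := horth u hu p hp j
      have h2 : T (a j) u p = 0 := by rw [hT2]; exact h1
      simp only [map_add, map_smul, LinearMap.add_apply, LinearMap.smul_apply, smul_eq_mul,
        Pi.add_apply, Pi.smul_apply, h1, h2, hpd, ← hs]
      ring
  · refine lt_of_le_of_ne le_sup_left ?_
    intro h
    apply hnot
    rw [h]
    exact Submodule.mem_sup_right (Submodule.mem_span_singleton_self _)

/-- Prescribing values of quadratic forms on finite-codimensional subspaces. -/
theorem aux_values [IsAlgClosed k] (T : V →ₗ[k] V →ₗ[k] V →ₗ[k] k)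
    (hT2 : ∀ x y z, T x y z = T x z y) (N : Submodule k V)
    (hN : ∀ (v : V) (U : Submodule k V), U.CoFG → (∀ x ∈ U, T v x x = 0) → v ∈ N)
    {ι : Type*} [Fintype ι] (a : ι → V) (U : Submodule k V) (hU : U.CoFG) (c : ι → k)
    (hc : ∀ φ : ι → k, ∑ j, φ j • a j ∈ N → ∑ j, φ j * c j = 0) :
    ∃ u ∈ U, ∀ j, T (a j) u u = c j := by
  classical
  obtain ⟨D, P, U', -, hPU, hU', -, hD, -, hU'D⟩ := aux_max T hT2 a U hU
  by_cases hcD : c ∈ D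
  · obtain ⟨p, hp, h⟩ := hD c hcD
    exact ⟨p, hPU hp, h⟩
  exfalso
  obtain ⟨f, hfc, hf⟩ := Submodule.exists_le_ker_of_notMem hcD
  have hfe : ∀ d : ι → k, f d = ∑ j, f (Pi.single j 1) * d j := by
    intro d
    conv_lhs => rw [pi_eq_sum_univ' d]
    simp [mul_comm, Pi.single]
  apply hfc
  rw [hfe]
  apply hc
  apply hN _ U' hU'
  intro x hx
  have := hf (hU'D x hx)
  rw [LinearMap.mem_ker, hfe] at this
  simpa [map_sum, LinearMap.sum_apply] using this

/-- Common isotropic vectors outside a subspace of infinite codimension. -/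
theorem aux_zero [IsAlgClosed k] (T : V →ₗ[k] V →ₗ[k] V →ₗ[k] k)
    (hT2 : ∀ x y z, T x y z = T x z y) (M : Submodule k V) (hM : ¬ M.CoFG)
    {ι : Type*} [Fintype ι] (a : ι → V) (U : Submodule k V) (hU : U.CoFG) :
    ∃ u ∈ U, u ∉ M ∧ ∀ j, T (a j) u u = 0 := by
  obtain ⟨D, P, U', hP, hPU, hU', hU'U, hD, horth, hU'D⟩ := aux_max T hT2 a U hU
  obtain ⟨u, hu, huM⟩ := aux_exists_notMem hU' (fun h => hM (aux_cofg_of_sup hP h))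
  obtain ⟨p, hp, hpd⟩ := hD _ (D.neg_mem (hU'D u hu))
  refine ⟨p + u, U.add_mem (hPU hp) (hU'U hu), ?_, ?_⟩
  · intro h
    apply huM
    have : u = (p + u) + (-p) := by abel
    rw [this]
    exact Submodule.add_mem_sup h (P.neg_mem hp)
  · intro j
    have h1 := horth u hu p hp j
    have h2 : T (a j) u p = 0 := by rw [hT2]; exact h1
    simp [h1, h2, hpd]

/-- A vector isotropic for finitely many quadratic forms, not for the cubic form. -/
theorem aux_cubic [IsAlgClosed k] (hk2 : (2 : k) ≠ 0) (hk3 : (3 : k) ≠ 0)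
    (T : V →ₗ[k] V →ₗ[k] V →ₗ[k] k) (hT1 : ∀ x y z, T x y z = T y x z)
    (hT2 : ∀ x y z, T x y z = T x z y) (N : Submodule k V)
    (hN : ∀ (v : V) (U : Submodule k V), U.CoFG → (∀ x ∈ U, T v x x = 0) → v ∈ N)
    (hNi : ¬ N.CoFG)
    {ι : Type*} [Fintype ι] (b : ι → V) (U : Submodule k V) (hU : U.CoFG) :
    ∃ r ∈ U, (∀ j, T (b j) r r = 0) ∧ T r r r ≠ 0 := by
  have hBfg : (Submodule.span k (Set.range b)).FG := Submodule.fg_span (Set.finite_range b)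
  obtain ⟨a, haU, haM, hab⟩ := aux_zero T hT2 (N ⊔ Submodule.span k (Set.range b))
    (fun h => hNi (aux_cofg_of_sup hBfg h)) b U hU
  by_cases haa : T a a a = 0
  swap
  · exact ⟨a, haU, hab, haa⟩
  obtain ⟨U1, hU1, hperp⟩ := aux_perp T
    (G := Submodule.span k {a} ⊔ Submodule.span k (Set.range b))
    ((Submodule.fg_span_singleton a).sup hBfg)
  have haG : a ∈ Submodule.span k {a} ⊔ Submodule.span k (Set.range b) :=
    Submodule.mem_sup_left (Submodule.mem_span_singleton_self a)
  have hbG : ∀ j, b j ∈ Submodule.span k {a} ⊔ Submodule.span k (Set.range b) := fun j =>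
    Submodule.mem_sup_right (Submodule.subset_span ⟨j, rfl⟩)
  obtain ⟨t, ht, htv⟩ := aux_values T hT2 N hN (ι := Option ι)
    (fun o => o.elim a b) (U ⊓ U1) (hU.inf hU1) (fun o => o.elim 1 (fun _ => 0)) (by
      intro φ hφ
      simp only [Fintype.sum_option, Option.elim] at hφ ⊢
      simp only [mul_one, mul_zero, Finset.sum_const_zero, add_zero]
      by_contra h0
      apply haM
      have hs : ∑ j, φ (some j) • b j ∈ Submodule.span k (Set.range b) :=
        Submodule.sum_mem _ (fun j _ => Submodule.smul_mem _ _ (Submodule.subset_span ⟨j, rfl⟩))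
      have : φ none • a ∈ N ⊔ Submodule.span k (Set.range b) := by
        have h2 := Submodule.add_mem_sup hφ (Submodule.neg_mem _ hs)
        simpa using h2
      exact (Submodule.smul_mem_iff _ h0).1 this)
  have hat : T a t t = 1 := htv none
  have hbt : ∀ j, T (b j) t t = 0 := fun j => htv (some j)
  have haat : T a a t = 0 := hperp t ht.2 a haG a haG
  have hbat : ∀ j, T (b j) a t = 0 := fun j => hperp t ht.2 _ (hbG j) a haG
  have e1 : T a t a = 0 := by rw [hT2]; exact haat
  have e2 : T t a a = 0 := by rw [hT1]; exact e1
  have e3 : T t a t = 1 := by rw [hT1]; exact hat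
  have e4 : T t t a = 1 := by rw [hT2]; exact e3
  have e5 : ∀ j, T (b j) t a = 0 := fun j => by rw [hT2]; exact hbat j
  have key : ∀ σ : k, T (a + σ • t) (a + σ • t) (a + σ • t) = σ ^ 2 * (3 + σ * T t t t) := by
    intro σ
    simp only [map_add, map_smul, LinearMap.add_apply, LinearMap.smul_apply, smul_eq_mul,
      haa, hat, haat, e1, e2, e3, e4]
    ring
  have key2 : ∀ σ : k, ∀ j, T (b j) (a + σ • t) (a + σ • t) = 0 := by
    intro σ j
    simp [hab, hbt, hbat, e5]
  have key3 : ∀ σ : k, a + σ • t ∈ U := fun σ => U.add_mem haU (U.smul_mem _ ht.1)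
  by_cases h1 : 3 + T t t t = 0
  · refine ⟨_, key3 (-1), key2 (-1), ?_⟩
    rw [key]
    intro h
    have : (2 : k) * 3 = 0 := by linear_combination h1 + h
    exact (mul_ne_zero hk2 hk3) this
  · refine ⟨_, key3 1, key2 1, ?_⟩
    rw [key]
    simpa using h1

/-- The inductive step. -/
theorem aux_step [IsAlgClosed k] (hk2 : (2 : k) ≠ 0) (hk3 : (3 : k) ≠ 0)
    (T : V →ₗ[k] V →ₗ[k] V →ₗ[k] k) (hT1 : ∀ x y z, T x y z = T y x z)
    (hT2 : ∀ x y z, T x y z = T x z y) (N : Submodule k V)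
    (hN : ∀ (v : V) (U : Submodule k V), U.CoFG → (∀ x ∈ U, T v x x = 0) → v ∈ N)
    (hNi : ¬ N.CoFG)
    {ι : Type*} [Fintype ι] (w : ι → V) (hw : LinearIndependent k (fun i => N.mkQ (w i)))
    (β : ι → k) :
    ∃ v, v ∉ N ⊔ Submodule.span k (Set.range w) ∧ (∀ i j, T (w i) (w j) v = 0) ∧
      (∀ i, T (w i) v v = β i) ∧ T v v v = 0 := by
  have hFfg : (Submodule.span k (Set.range w)).FG := Submodule.fg_span (Set.finite_range w)
  set F := Submodule.span k (Set.range w) with hF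
  have hwF : ∀ i, w i ∈ F := fun i => Submodule.subset_span ⟨i, rfl⟩
  obtain ⟨U, hU, hUF⟩ := aux_perp T hFfg
  obtain ⟨x, hxU, hxM⟩ := aux_exists_notMem hU (fun h => hNi (aux_cofg_of_sup hFfg h))
  obtain ⟨l, hlx, hl⟩ := Submodule.exists_le_ker_of_notMem hxM
  have hUl : (U ⊓ LinearMap.ker l).CoFG := hU.inf (Submodule.CoFG.ker l)
  -- first correction: the quadratic values
  obtain ⟨U1, hU1, hperp1⟩ := aux_perp T (G := F ⊔ Submodule.span k {x})
    (hFfg.sup (Submodule.fg_span_singleton x))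
  obtain ⟨t, ht, htv⟩ := aux_values T hT2 N hN w _ (hUl.inf hU1)
    (fun i => β i - T (w i) x x) (by
      intro φ hφ
      have h0 : ∑ j, φ j • N.mkQ (w j) = 0 := by
        have := (Submodule.Quotient.mk_eq_zero N).2 hφ
        rw [← Submodule.mkQ_apply] at this
        simpa only [map_sum, map_smul] using this
      have := Fintype.linearIndependent_iff.1 hw φ h0
      simp [this])
  have hwxt : ∀ i, T (w i) x t = 0 := fun i => hperp1 t ht.2 _ (Submodule.mem_sup_left (hwF i)) _
    (Submodule.mem_sup_right (Submodule.mem_span_singleton_self x))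
  have hwtx : ∀ i, T (w i) t x = 0 := fun i => by rw [hT2]; exact hwxt i
  obtain ⟨y, hy⟩ : ∃ y, y = x + t := ⟨_, rfl⟩
  have hyU : y ∈ U := hy ▸ U.add_mem hxU ht.1.1
  have hly : l y ≠ 0 := by
    have : l t = 0 := ht.1.2
    rw [hy, map_add, this, add_zero]; exact hlx
  have hwy : ∀ i, T (w i) y y = β i := by
    intro i
    simp [hy, hwxt, hwtx, htv]
  clear_value F
  -- second correction: the cubic value
  obtain ⟨U2, hU2, hperp2⟩ := aux_perp T (G := F ⊔ Submodule.span k {y})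
    (hFfg.sup (Submodule.fg_span_singleton y))
  have hyG : y ∈ F ⊔ Submodule.span k {y} :=
    Submodule.mem_sup_right (Submodule.mem_span_singleton_self y)
  obtain ⟨r0, hr0, hr0q, hr0c⟩ := aux_cubic hk2 hk3 T hT1 hT2 N hN hNi
    (fun o : Option ι => o.elim y w) _ (hUl.inf hU2)
  obtain ⟨s, hs⟩ := IsAlgClosed.exists_pow_nat_eq (-(T y y y) / T r0 r0 r0) (n := 3) (by norm_num)
  obtain ⟨r, hr⟩ : ∃ r, r = s • r0 := ⟨_, rfl⟩
  have hrU : r ∈ (U ⊓ LinearMap.ker l) ⊓ U2 := hr ▸ Submodule.smul_mem _ _ hr0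
  have hwr : ∀ i, T (w i) r r = 0 := by
    intro i
    have : T (w i) r0 r0 = 0 := hr0q (some i)
    simp [hr, this]
  have hyr : T y r r = 0 := by
    have : T y r0 r0 = 0 := hr0q none
    simp [hr, this]
  have hrr : T r r r = - T y y y := by
    have : T r r r = s ^ 3 * T r0 r0 r0 := by
      simp [hr]; ring
    rw [this, hs, div_mul_cancel₀ _ hr0c]
  have hyyr : T y y r = 0 := hperp2 r hrU.2 y hyG y hyG
  have hwyr : ∀ i, T (w i) y r = 0 := fun i =>
    hperp2 r hrU.2 _ (Submodule.mem_sup_left (hwF i)) y hyG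
  have hwry : ∀ i, T (w i) r y = 0 := fun i => by rw [hT2]; exact hwyr i
  have e1 : T y r y = 0 := by rw [hT2]; exact hyyr
  have e2 : T r y y = 0 := by rw [hT1]; exact e1
  have e3 : T r y r = 0 := by rw [hT1]; exact hyr
  have e4 : T r r y = 0 := by rw [hT2]; exact e3
  refine ⟨y + r, ?_, ?_, ?_, ?_⟩
  · intro h
    have h1 := hl h
    have h2 : l r = 0 := hrU.1.2
    rw [LinearMap.mem_ker, map_add, h2, add_zero] at h1
    exact hly h1
  · intro i j
    exact hUF _ (U.add_mem hyU hrU.1.1) _ (hwF i) _ (hwF j)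
  · intro i
    simp [hwy, hwyr, hwry, hwr]
  · simp [hyyr, e1, e2, e3, e4, hyr, hrr]

/-- The sequence with prescribed values. -/
theorem aux_seq [IsAlgClosed k] (hk2 : (2 : k) ≠ 0) (hk3 : (3 : k) ≠ 0)
    (T : V →ₗ[k] V →ₗ[k] V →ₗ[k] k) (hT1 : ∀ x y z, T x y z = T y x z)
    (hT2 : ∀ x y z, T x y z = T x z y) (N : Submodule k V)
    (hN : ∀ (v : V) (U : Submodule k V), U.CoFG → (∀ x ∈ U, T v x x = 0) → v ∈ N)
    (hNi : ¬ N.CoFG) (β : ℕ → ℕ → k) :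
    ∃ w : ℕ → V, (∀ n, ∀ i < n, ∀ j < n, T (w i) (w j) (w n) = 0) ∧
      (∀ n, ∀ i < n, T (w i) (w n) (w n) = β n i) ∧ ∀ n, T (w n) (w n) (w n) = 0 := by
  have step : ∀ (n : ℕ) (w : Fin n → V), ∃ v, LinearIndependent k (fun i => N.mkQ (w i)) →
      (v ∉ N ⊔ Submodule.span k (Set.range w) ∧ (∀ i j, T (w i) (w j) v = 0) ∧
      (∀ i, T (w i) v v = β n i) ∧ T v v v = 0) := by
    intro n w
    by_cases h : LinearIndependent k (fun i => N.mkQ (w i))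
    · obtain ⟨v, hv⟩ := aux_step hk2 hk3 T hT1 hT2 N hN hNi w h (fun i => β n i)
      exact ⟨v, fun _ => hv⟩
    · exact ⟨0, fun h' => absurd h' h⟩
  choose F hF using step
  let w : ℕ → V := fun n => Nat.strongRec (motive := fun _ => V)
    (fun n ih => F n (fun i => ih i.1 i.2)) n
  have hw : ∀ n, w n = F n (fun i => w i) := by
    intro n
    simp only [w]
    rw [Nat.strongRec_eq]
  have hLI : ∀ n, LinearIndependent k (fun i : Fin n => N.mkQ (w i)) := by
    intro n
    induction n with
    | zero => exact linearIndependent_empty_type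
    | succ n ih =>
      rw [linearIndependent_finSucc']
      refine ⟨ih, ?_⟩
      have h := (hF n (fun i => w i) ih).1
      rw [← hw] at h
      intro hmem
      apply h
      have : Set.range (Fin.init fun i : Fin (n + 1) => N.mkQ (w i)) =
          N.mkQ '' Set.range (fun i : Fin n => w i) := by
        rw [← Set.range_comp]; rfl
      rw [this, Submodule.span_image] at hmem
      obtain ⟨p, hp, hpe⟩ := hmem
      have hp2 : w n - p ∈ N := by
        have := hpe.symm
        simp only [Fin.val_last, Submodule.mkQ_apply] at this
        exact (Submodule.Quotient.eq N).1 this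
      have := Submodule.add_mem_sup hp2 hp
      simpa using this
  have H := fun n => hF n (fun i => w i) (hLI n)
  simp only [← hw] at H
  exact ⟨w, fun n i hi j hj => (H n).2.1 ⟨i, hi⟩ ⟨j, hj⟩, fun n i hi => (H n).2.2.1 ⟨i, hi⟩,
    fun n => (H n).2.2.2⟩

end CubicAux

section CubicAux2

variable {k V : Type*} [Field k] [AddCommGroup V] [Module k V]

/-- A quadratic form `f_v` vanishing on a subspace of finite codimension has finite strength. -/
theorem aux_finStrength (T : V →ₗ[k] V →ₗ[k] V →ₗ[k] k)
    (hT2 : ∀ x y z, T x y z = T x z y) (v : V) (U : Submodule k V) (hU : U.CoFG)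
    (h : ∀ x ∈ U, T v x x = 0) : fQuad T v ∈ FinStrength k V := by
  obtain ⟨C, hC⟩ := Submodule.exists_isCompl U
  have hCfg : C.FG := Submodule.CoFG.fg_of_isCompl hC hU
  have : Module.Finite k C := Module.Finite.iff_fg.2 hCfg
  let π : V →ₗ[k] C := Submodule.projectionOnto C U hC.symm
  have hπ : ∀ x, x - (π x : V) ∈ U := by
    intro x
    rw [← Submodule.projectionOnto_apply_eq_zero_iff hC.symm, map_sub,
      Submodule.projectionOnto_apply_left, sub_self]
  let b := Module.finBasis k C
  refine ⟨Module.finrank k C, fun i => b.coord i ∘ₗ π,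
    fun i => (3 : k) • ((T v (b i)) ∘ₗ ((2 : k) • LinearMap.id - C.subtype ∘ₗ π)), ?_⟩
  intro x
  have h1 := h _ (hπ x)
  have h2 : (π x : V) = ∑ i, b.coord i (π x) • (b i : V) := by
    have := congrArg C.subtype (b.sum_repr (π x))
    rw [map_sum] at this
    exact this.symm
  have h3 : T v x x = T v (π x) ((2 : k) • x - (π x : V)) := by
    simp only [map_sub, LinearMap.sub_apply, map_smul, smul_eq_mul] at h1 ⊢
    rw [hT2 v x (π x)] at h1
    linear_combination h1
  have h4 : T v (π x) ((2 : k) • x - (π x : V)) =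
      ∑ i, b.coord i (π x) * T v (b i) ((2 : k) • x - (π x : V)) := by
    generalize (2 : k) • x - (π x : V) = z
    conv_lhs => rw [h2]
    simp only [map_sum, LinearMap.sum_apply, map_smul, LinearMap.smul_apply, smul_eq_mul]
  have h5 : fQuad T v x = 3 * T v x x := by simp [fQuad]
  rw [h5, h3, h4, Finset.mul_sum]
  refine Finset.sum_congr rfl fun i _ => ?_
  simp only [LinearMap.comp_apply, LinearMap.smul_apply, LinearMap.sub_apply, LinearMap.id_apply,
    Submodule.subtype_apply, smul_eq_mul]
  ring

/-- The linear map sending `v` to the class of `f_v`. -/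
noncomputable def auxCl (T : V →ₗ[k] V →ₗ[k] V →ₗ[k] k) :
    V →ₗ[k] (QuadraticForm k V ⧸ FinStrength k V) :=
  (FinStrength k V).mkQ ∘ₗ
    { toFun := fQuad T
      map_add' := fun x y => by ext z; simp [fQuad, mul_add]
      map_smul' := fun c x => by ext z; simp [fQuad, mul_left_comm] }

theorem aux_ker_not_cofg (T : V →ₗ[k] V →ₗ[k] V →ₗ[k] k)
    (h : Cardinal.aleph0 ≤ rrk k T) : ¬ (LinearMap.ker (auxCl T)).CoFG := by
  intro hc
  have hfg := Submodule.range_fg_iff_ker_cofg.2 hc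
  have hspan : Submodule.span k
    (Set.range fun v => Submodule.Quotient.mk (p := FinStrength k V) (fQuad T v)) =
      LinearMap.range (auxCl T) := by
    rw [← Submodule.span_eq (LinearMap.range (auxCl T)), LinearMap.coe_range]
    rfl
  unfold rrk at h
  rw [hspan] at h
  have : Module.Finite k (LinearMap.range (auxCl T)) := Module.Finite.iff_fg.2 hfg
  exact absurd (Module.rank_lt_aleph0 k (LinearMap.range (auxCl T))) (not_lt.2 h)

/-- Trilinear values on the sequence. -/
theorem aux_formula (T : V →ₗ[k] V →ₗ[k] V →ₗ[k] k) (hT1 : ∀ x y z, T x y z = T y x z)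
    (hT2 : ∀ x y z, T x y z = T x z y) (β : ℕ → ℕ → k) (w : ℕ → V)
    (h0 : ∀ n, ∀ i < n, ∀ j < n, T (w i) (w j) (w n) = 0)
    (h1 : ∀ n, ∀ i < n, T (w i) (w n) (w n) = β n i) (h2 : ∀ n, T (w n) (w n) (w n) = 0)
    (a b c : ℕ) : T (w a) (w b) (w c) = (if b = c ∧ a < b then β b a else 0) +
      (if a = c ∧ b < a then β a b else 0) + (if a = b ∧ c < a then β a c else 0) := by
  have m2 : ∀ n, ∀ i < n, ∀ j < n, T (w i) (w n) (w j) = 0 := fun n i hi j hj => by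
    rw [hT2]; exact h0 n i hi j hj
  have m1 : ∀ n, ∀ i < n, ∀ j < n, T (w n) (w i) (w j) = 0 := fun n i hi j hj => by
    rw [hT1]; exact m2 n i hi j hj
  have q2 : ∀ n, ∀ i < n, T (w n) (w i) (w n) = β n i := fun n i hi => by
    rw [hT1]; exact h1 n i hi
  have q3 : ∀ n, ∀ i < n, T (w n) (w n) (w i) = β n i := fun n i hi => by
    rw [hT2]; exact q2 n i hi
  clear hT1 hT2
  rcases lt_trichotomy a b with hab | hab | hab <;>
  rcases lt_trichotomy b c with hbc | hbc | hbc <;>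
  rcases lt_trichotomy a c with hac | hac | hac <;> first | omega | grind

/-- The model vectors. -/
theorem aux_model [IsAlgClosed k] (hk2 : (2 : k) ≠ 0) (hk3 : (3 : k) ≠ 0)
    (T : V →ₗ[k] V →ₗ[k] V →ₗ[k] k) (hT1 : ∀ x y z, T x y z = T y x z)
    (hT2 : ∀ x y z, T x y z = T x z y)
    (hV : Cardinal.aleph0 ≤ rrk k T) :
    ∃ (x : ℕ → V) (u : Bool → ℕ → ℕ → V),
      (∀ a b c, T (x a) (x b) (x c) = 0) ∧
      (∀ a b e i j, T (x a) (x b) (u e i j) = 0) ∧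
      (∀ a e i j e' i' j', T (x a) (u e i j) (u e' i' j') =
        if e = e' ∧ i = i' ∧ j = j' ∧ a = i then 1 else 0) ∧
      (∀ e i j e' i' j' e'' i'' j'', T (u e i j) (u e' i' j') (u e'' i'' j'') = 0) := by
  let β : ℕ → ℕ → k := fun n i => if n % 3 ≠ 0 ∧ i = 3 * (Nat.unpair (n / 3)).1 then 1 else 0
  obtain ⟨w, h0, h1, h2⟩ := aux_seq hk2 hk3 T hT1 hT2 (LinearMap.ker (auxCl T))
    (fun v U hU h => by
      rw [LinearMap.mem_ker]
      exact (Submodule.Quotient.mk_eq_zero _).2 (aux_finStrength T hT2 v U hU h))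
    (aux_ker_not_cofg T hV) β
  have G := aux_formula T hT1 hT2 β w h0 h1 h2
  let c : Bool → ℕ := fun e => if e then 2 else 1
  have hc : ∀ e, c e = 1 ∨ c e = 2 := by intro e; cases e <;> simp [c]
  have hcinj : ∀ e e', c e = c e' → e = e' := by
    intro e e'; cases e <;> cases e' <;> simp [c]
  have hβ0 : ∀ n i, n % 3 = 0 → β n i = 0 := fun n i h => by simp [β, h]
  have hβ1 : ∀ n i, i % 3 ≠ 0 → β n i = 0 := fun n i h => by
    simp only [β]; rw [if_neg]; omega
  have hβ2 : ∀ e i j a, β (3 * Nat.pair i j + c e) (3 * a) = if a = i then 1 else 0 := by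
    intro e i j a
    have e1 : (3 * Nat.pair i j + c e) / 3 = Nat.pair i j := by have := hc e; omega
    have e2 : (3 * Nat.pair i j + c e) % 3 ≠ 0 := by have := hc e; omega
    simp only [β, e1, e2, Nat.unpair_pair, ne_eq, not_false_eq_true, true_and]
    simp
  refine ⟨fun a => w (3 * a), fun e i j => w (3 * Nat.pair i j + c e), ?_, ?_, ?_, ?_⟩
  · intro a b d
    simp [G, hβ0]
  · intro a b e i j
    have := hc e
    rw [G, if_neg (by omega), if_neg (by omega)]
    simp [hβ0]
  · intro a e i j e' i' j'
    have he := hc e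
    have he' := hc e'
    rw [G, hβ0 (3 * a) _ (by omega), hβ0 (3 * a) _ (by omega), hβ2, ite_self, ite_self, add_zero,
      add_zero]
    have hp := Nat.left_le_pair i j
    by_cases h : e = e' ∧ i = i' ∧ j = j'
    · obtain ⟨rfl, rfl, rfl⟩ := h
      by_cases ha : a = i
      · subst ha
        rw [if_pos (by omega)]; simp
      · simp [ha]
    · rw [if_neg, if_neg]
      · tauto
      · rintro ⟨h3, -⟩
        have h4 : Nat.pair i j = Nat.pair i' j' := by omega
        have h5 : c e = c e' := by omega
        have h6 := Nat.pair_eq_pair.1 h4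
        exact h ⟨hcinj _ _ h5, h6⟩
  · intro e i j e' i' j' e'' i'' j''
    have he := hc e
    have he' := hc e'
    have he'' := hc e''
    rw [G, hβ1 _ _ (by omega), hβ1 _ _ (by omega), hβ1 _ _ (by omega)]
    simp

/-- Weights on weakly increasing triples whose symmetrization is `R`. -/
theorem aux_weights {k : Type*} [Field k] (hk2 : (2 : k) ≠ 0) (hk3 : (3 : k) ≠ 0)
    (R : ℕ → ℕ → ℕ → k) (hR1 : ∀ x y z, R x y z = R y x z) (hR2 : ∀ x y z, R x y z = R x z y) :
    ∃ s : ℕ → ℕ → ℕ → k, (∀ i j m, ¬ (i ≤ j ∧ j ≤ m) → s i j m = 0) ∧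
      ∀ a b c, s a b c + s a c b + s b a c + s b c a + s c a b + s c b a = R a b c := by
  let s : ℕ → ℕ → ℕ → k := fun i j m => if i ≤ j ∧ j ≤ m then
    (if i = j then (if j = m then 6⁻¹ else 2⁻¹) else (if j = m then 2⁻¹ else 1)) * R i j m else 0
  have hk6 : (6 : k) ≠ 0 := by
    have : (6 : k) = 2 * 3 := by norm_num
    rw [this]; exact mul_ne_zero hk2 hk3
  have e2 : (2 : k)⁻¹ * 2 = 1 := inv_mul_cancel₀ hk2
  have e6 : (6 : k)⁻¹ * 6 = 1 := inv_mul_cancel₀ hk6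
  refine ⟨s, fun i j m h => by simp only [s]; rw [if_neg h], ?_⟩
  have sorted : ∀ a b c, a ≤ b → b ≤ c →
      s a b c + s a c b + s b a c + s b c a + s c a b + s c b a = R a b c := by
    intro a b c hab hbc
    rcases hab.lt_or_eq with h1 | rfl <;> rcases hbc.lt_or_eq with h2 | rfl
    · have : a < c := h1.trans h2
      simp [s, h1.le, h2.le, h1.not_ge, h2.not_ge, h1.ne, h2.ne, this.not_ge]
    · simp [s, h1.le, h1.not_ge, h1.ne]
      linear_combination (R a b b) * e2
    · simp [s, h2.le, h2.not_ge, h2.ne]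
      linear_combination (R a a c) * e2
    · simp [s]
      linear_combination (R a a a) * e6
  intro a b c
  rcases le_total a b with h1 | h1 <;> rcases le_total b c with h2 | h2 <;>
    rcases le_total a c with h3 | h3
  · rw [← sorted a b c h1 h2]
  · rw [← sorted a b c h1 h2]
  · rw [hR2, ← sorted a c b h3 h2]; ring
  · rw [hR2, hR1, ← sorted c a b h3 h1]; ring
  · rw [hR1, ← sorted b a c h1 h3]; ring
  · rw [hR1, hR2, ← sorted b c a h2 h3]; ring
  · rw [hR1, hR2, hR1, ← sorted c b a h2 h1]; ring
  · rw [hR1, hR2, hR1, ← sorted c b a h2 h1]; ring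

/-- Realizing an arbitrary symmetric array. -/
theorem aux_realize [IsAlgClosed k] (hk2 : (2 : k) ≠ 0) (hk3 : (3 : k) ≠ 0)
    (T : V →ₗ[k] V →ₗ[k] V →ₗ[k] k) (hT1 : ∀ x y z, T x y z = T y x z)
    (hT2 : ∀ x y z, T x y z = T x z y)
    (hV : Cardinal.aleph0 ≤ rrk k T)
    (R : ℕ → ℕ → ℕ → k) (hR1 : ∀ x y z, R x y z = R y x z) (hR2 : ∀ x y z, R x y z = R x z y) :
    ∃ Φ : ℕ → V, ∀ a b c, T (Φ a) (Φ b) (Φ c) = R a b c := by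
  obtain ⟨x, u, hxxx, hxxu, hxuu, huuu⟩ := aux_model hk2 hk3 T hT1 hT2 hV
  obtain ⟨s, hs0, hs⟩ := aux_weights hk2 hk3 R hR1 hR2
  obtain ⟨ι, hι⟩ := IsAlgClosed.exists_pow_nat_eq (-1 : k) (n := 2) (by norm_num)
  have e2 : (2 : k)⁻¹ * 2 = 1 := inv_mul_cancel₀ hk2
  let y : ℕ → ℕ → V := fun i j => u false i j + ι • u true i j
  let z : ℕ → ℕ → V := fun i j => (2 : k)⁻¹ • (u false i j - ι • u true i j)
  have hyy : ∀ a i j i' j', T (x a) (y i j) (y i' j') = 0 := by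
    intro a i j i' j'
    simp only [y, map_add, map_smul, LinearMap.add_apply, LinearMap.smul_apply, smul_eq_mul, hxuu]
    by_cases h : i = i' ∧ j = j' ∧ a = i
    · simp [h]; linear_combination hι
    · simp [h]
  have hzz : ∀ a i j i' j', T (x a) (z i j) (z i' j') = 0 := by
    intro a i j i' j'
    simp only [z, map_sub, map_smul, LinearMap.sub_apply, LinearMap.smul_apply, smul_eq_mul, hxuu]
    by_cases h : i = i' ∧ j = j' ∧ a = i
    · simp [h]; right; linear_combination 2⁻¹ * hι
    · simp [h]
  have hyz : ∀ a i j i' j', T (x a) (y i j) (z i' j') =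
      if i = i' ∧ j = j' ∧ a = i then 1 else 0 := by
    intro a i j i' j'
    simp only [y, z, map_add, map_sub, map_smul, LinearMap.add_apply, LinearMap.sub_apply,
      LinearMap.smul_apply, smul_eq_mul, hxuu]
    by_cases h : i = i' ∧ j = j' ∧ a = i
    · simp [h]; linear_combination e2 - 2⁻¹ * hι
    · simp [h]
  let Y : ℕ → V := fun m => ∑ i ∈ Finset.range (m + 1), y i m
  let Z : ℕ → V := fun m => ∑ i ∈ Finset.range (m + 1), ∑ j ∈ Finset.range (m + 1), s i j m • z i j
  let Q : Submodule k V := Submodule.span k (Set.range fun p : Bool × ℕ × ℕ => u p.1 p.2.1 p.2.2)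
  have hu : ∀ e i j, u e i j ∈ Q := fun e i j => Submodule.subset_span ⟨(e, i, j), rfl⟩
  have hYQ : ∀ m, Y m ∈ Q := fun m => Submodule.sum_mem _ fun i _ =>
    Q.add_mem (hu _ _ _) (Q.smul_mem _ (hu _ _ _))
  have hZQ : ∀ m, Z m ∈ Q := fun m => Submodule.sum_mem _ fun i _ => Submodule.sum_mem _ fun j _ =>
    Q.smul_mem _ (Q.smul_mem _ (Q.sub_mem (hu _ _ _) (Q.smul_mem _ (hu _ _ _))))
  have hxxQ : ∀ a b, ∀ q ∈ Q, T (x a) (x b) q = 0 := by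
    intro a b q hq
    have : Q ≤ LinearMap.ker (T (x a) (x b)) := by
      rw [Submodule.span_le]
      rintro _ ⟨p, rfl⟩
      exact hxxu _ _ _ _ _
    exact this hq
  have hQQQ : ∀ p ∈ Q, ∀ q ∈ Q, ∀ r ∈ Q, T p q r = 0 := by
    intro p hp q hq r hr
    induction hp using Submodule.span_induction with
    | zero => simp
    | add y z _ _ h1 h2 => simp [h1, h2]
    | smul c y _ h1 => simp [h1]
    | mem p hp =>
    induction hq using Submodule.span_induction with
    | zero => simp
    | add y z _ _ h1 h2 => simp [h1, h2]
    | smul c y _ h1 => simp [h1]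
    | mem q hq =>
    induction hr using Submodule.span_induction with
    | zero => simp
    | add y z _ _ h1 h2 => simp [h1, h2]
    | smul c y _ h1 => simp [h1]
    | mem r hr =>
      obtain ⟨p, rfl⟩ := hp
      obtain ⟨q, rfl⟩ := hq
      obtain ⟨r, rfl⟩ := hr
      exact huuu _ _ _ _ _ _ _ _ _
  have hYY : ∀ a b c, T (x a) (Y b) (Y c) = 0 := by
    intro a b c
    simp [Y, map_sum, LinearMap.sum_apply, hyy]
  have hZZ : ∀ a b c, T (x a) (Z b) (Z c) = 0 := by
    intro a b c
    simp [Z, map_sum, LinearMap.sum_apply, hzz]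
  have hYZ : ∀ a b c, T (x a) (Y b) (Z c) = s a b c := by
    intro a b c
    have h1 : ∀ i, T (x a) (y i b) (Z c) = if a = i then s a b c else 0 := by
      intro i
      simp only [Z, map_sum, map_smul, smul_eq_mul, hyz]
      by_cases ha : a = i
      · subst ha
        by_cases h : a ≤ b ∧ b ≤ c
        · have h3 : a < c + 1 := by omega
          have h4 : b < c + 1 := by omega
          simp [ite_and, h3, h4]
        · rw [hs0 a b c h, ite_self]
          refine Finset.sum_eq_zero fun i _ => Finset.sum_eq_zero fun j _ => ?_
          by_cases h3 : a = i ∧ b = j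
          · obtain ⟨rfl, rfl⟩ := h3
            rw [hs0 a b c h, zero_mul]
          · rw [if_neg (by tauto), mul_zero]
      · simp [ha]
    have h2 : T (x a) (Y b) (Z c) = ∑ i ∈ Finset.range (b + 1), T (x a) (y i b) (Z c) := by
      simp only [Y, map_sum, LinearMap.sum_apply]
    rw [h2, Finset.sum_congr rfl fun i _ => h1 i, Finset.sum_ite_eq]
    by_cases h : a < b + 1
    · rw [if_pos (Finset.mem_range.2 h)]
    · rw [hs0 a b c (by omega), ite_self]
  have hZY : ∀ a b c, T (x a) (Z c) (Y b) = s a b c := fun a b c => by rw [hT2]; exact hYZ a b c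
  refine ⟨fun m => x m + (Y m + Z m), fun a b c => ?_⟩
  have expand : ∀ p p' p'' q q' q'' : V, T (p + q) (p' + q') (p'' + q'') =
      T p p' p'' + T p p' q'' + T p p'' q' + T p' p'' q + T p q' q'' + T p' q q'' + T p'' q q' +
        T q q' q'' := by
    intro p p' p'' q q' q''
    simp only [map_add, LinearMap.add_apply]
    rw [hT2 p q' p'', hT1 q p' p'', hT2 p' q p'', hT1 q p' q'', hT2 q q' p'', hT1 q p'' q']
    ring
  have hYZQ : ∀ m, Y m + Z m ∈ Q := fun m => Q.add_mem (hYQ m) (hZQ m)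
  rw [expand, hxxx, hxxQ _ _ _ (hYZQ _), hxxQ _ _ _ (hYZQ _), hxxQ _ _ _ (hYZQ _),
    hQQQ _ (hYZQ _) _ (hYZQ _) _ (hYZQ _), ← hs a b c]
  simp only [map_add, LinearMap.add_apply, hYY, hZZ, hYZ, hZY]
  ring

end CubicAux2

/-- Proposition 4.1 of the paper. If a cubic space `(V,T)` has infinite
residual rank, then every cubic space of countable dimension embeds into it. -/
theorem cubic_embedding_of_infinite_rrk
    {k V W : Type*} [Field k] [IsAlgClosed k]
    (hk2 : (2 : k) ≠ 0) (hk3 : (3 : k) ≠ 0)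
    [AddCommGroup V] [Module k V] [AddCommGroup W] [Module k W]
    (T : V →ₗ[k] V →ₗ[k] V →ₗ[k] k)
    (hT1 : ∀ x y z, T x y z = T y x z) (hT2 : ∀ x y z, T x y z = T x z y)
    (hVrrk : Cardinal.aleph0 ≤ rrk k T)
    (S : W →ₗ[k] W →ₗ[k] W →ₗ[k] k)
    (hS1 : ∀ x y z, S x y z = S y x z) (hS2 : ∀ x y z, S x y z = S x z y)
    (hW : Module.rank k W ≤ Cardinal.aleph0) :
    ∃ φ : W →ₗ[k] V, ∀ x y z, T (φ x) (φ y) (φ z) = S x y z := by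
  let b := Module.Basis.ofVectorSpace k W
  have hcard : Cardinal.mk (Module.Basis.ofVectorSpaceIndex k W) ≤ Cardinal.aleph0 := by
    rw [b.mk_eq_rank'']; exact hW
  have : Countable (Module.Basis.ofVectorSpaceIndex k W) := Cardinal.mk_le_aleph0_iff.1 hcard
  obtain ⟨f, hf⟩ := exists_injective_nat (Module.Basis.ofVectorSpaceIndex k W)
  let e : ℕ → W := Function.extend f b 0
  have he : ∀ i, e (f i) = b i := fun i => hf.extend_apply _ _ _
  obtain ⟨Φ, hΦ⟩ := aux_realize hk2 hk3 T hT1 hT2 hVrrk (fun i j m => S (e i) (e j) (e m))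
    (fun _ _ _ => hS1 _ _ _) (fun _ _ _ => hS2 _ _ _)
  let φ : W →ₗ[k] V := b.constr k (fun i => Φ (f i))
  have hφ : ∀ i, φ (b i) = Φ (f i) := fun i => b.constr_basis k _ i
  refine ⟨φ, ?_⟩
  have h3 : ∀ i j, (T (φ (b i)) (φ (b j))) ∘ₗ φ = S (b i) (b j) := fun i j => b.ext fun l => by
    simp only [LinearMap.comp_apply, hφ, hΦ, he]
  have h2 : ∀ i, (T (φ (b i))).compl₁₂ φ φ = S (b i) := fun i => b.ext fun j => by
    rw [← h3]; rfl
  have h2' : ∀ i y z, T (φ (b i)) (φ y) (φ z) = S (b i) y z := fun i y z => by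
    rw [← h2]; rfl
  intro x y z
  have h1 : ((T.flip (φ y)).flip (φ z)) ∘ₗ φ = (S.flip y).flip z := b.ext fun i => h2' i y z
  exact LinearMap.congr_fun h1 x
end

section
/- Let (V,T) be a cubic space over k whose residual rank is infinite. Then there exists an embedding of cubic spaces V(∞) → V. -/
open scoped BigOperators

/-- The trilinear form on `ι →₀ k` with coefficients `c` relative to the standard basis:
`(x, y, z) ↦ ∑ u v w, x u • (y v • (z w • c u v w))`. -/
noncomputable def triBasis (k : Type*) [Field k] {ι : Type*} (c : ι → ι → ι → k) :
    (ι →₀ k) →ₗ[k] (ι →₀ k) →ₗ[k] (ι →₀ k) →ₗ[k] k :=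
  Finsupp.lsum k fun u => LinearMap.toSpanSingleton k _ <|
    Finsupp.lsum k fun v => LinearMap.toSpanSingleton k _ <|
      Finsupp.lsum k fun w => LinearMap.toSpanSingleton k k (c u v w)

/-- Pullback of a trilinear form along a linear map: `comp3 T f x y z = T (f x) (f y) (f z)`. -/
noncomputable def comp3 {k A B : Type*} [Field k] [AddCommGroup A] [Module k A]
    [AddCommGroup B] [Module k B]
    (T : B →ₗ[k] B →ₗ[k] B →ₗ[k] k) (f : A →ₗ[k] B) :
    A →ₗ[k] A →ₗ[k] A →ₗ[k] k where
  toFun a := (T (f a)).compl₁₂ f f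
  map_add' a a' := by ext x y; simp [LinearMap.compl₁₂_apply, map_add]
  map_smul' c a := by ext x y; simp [LinearMap.compl₁₂_apply, map_smul]

/-- The underlying vector space of `V(∞)`: pairs of finitely supported functions. -/
abbrev VInf (k : Type*) [Field k] := (ℕ →₀ k) × ((ℕ × ℕ) →₀ k)

/-- `gInf u v w` is `1` exactly when `u = inl i` and `v = w = inr (i,j)` for some `i, j`. -/
def gInf (k : Type*) [Field k] : (ℕ ⊕ ℕ × ℕ) → (ℕ ⊕ ℕ × ℕ) → (ℕ ⊕ ℕ × ℕ) → k
  | Sum.inl i, Sum.inr p, Sum.inr q => if p = q ∧ p.1 = i then 1 else 0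
  | _, _, _ => 0

/-- Coefficients of the symmetric trilinear form `T∞` relative to the standard basis of
`(ℕ ⊕ ℕ × ℕ) →₀ k` (basis vectors indexed by `inl i` are the `x_i` coordinates, those
indexed by `inr (i,j)` the `y_{i,j}` coordinates). -/
def cInf (k : Type*) [Field k] (u v w : ℕ ⊕ ℕ × ℕ) : k :=
  gInf k u v w + gInf k v u w + gInf k w u v

/-- The identification of `V(∞)` with finitely supported functions on `ℕ ⊕ ℕ × ℕ`,
sending `(a, b)` to the function equal to `a` on `inl` and to `b` on `inr`. -/
noncomputable def eInf (k : Type*) [Field k] : VInf k →ₗ[k] ((ℕ ⊕ ℕ × ℕ) →₀ k) :=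
  (Finsupp.sumFinsuppLEquivProdFinsupp k).symm.toLinearMap

/-- The symmetric trilinear form `T∞` of the cubic space `V(∞)`:
`T∞((a,b),(a',b'),(a'',b'')) = ∑ i j, (a i * b' (i,j) * b'' (i,j)
  + a' i * b (i,j) * b'' (i,j) + a'' i * b (i,j) * b' (i,j))`,
whose associated cubic form is `F∞(a,b) = 3 * ∑ i, a i * (∑ j, (b (i,j))^2)`. -/
noncomputable def TInf (k : Type*) [Field k] :
    VInf k →ₗ[k] VInf k →ₗ[k] VInf k →ₗ[k] k :=
  comp3 (triBasis k (cInf k)) (eInf k)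

/-! ### Helper lemmas -/

/-- Finite-codimensional orthogonal subspace. -/
lemma exists_perp {k V : Type*} [Field k] [AddCommGroup V] [Module k V]
    (T : V →ₗ[k] V →ₗ[k] V →ₗ[k] k) (W F : Submodule k V) (hW : W.FG) (hF : F.FG) :
    ∃ U : Submodule k V, U.CoFG ∧ ∀ u ∈ U, ∀ w ∈ W, ∀ f ∈ F, T u w f = 0 := by
  have : Module.Finite k W := Module.Finite.iff_fg.2 hW
  have : Module.Finite k F := Module.Finite.iff_fg.2 hF
  let g : V →ₗ[k] (TensorProduct k W F →ₗ[k] k) :=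
    { toFun := fun v => TensorProduct.lift ((T v).compl₁₂ W.subtype F.subtype)
      map_add' := fun a a' => by ext x y; simp [LinearMap.compl₁₂_apply, map_add]
      map_smul' := fun c a => by ext x y; simp [LinearMap.compl₁₂_apply, map_smul] }
  refine ⟨LinearMap.ker g, Submodule.CoFG.ker g, fun u hu w hw f hf => ?_⟩
  have h1 : g u = 0 := LinearMap.mem_ker.1 hu
  exact congrArg (fun h => h (TensorProduct.tmul k ⟨w, hw⟩ ⟨f, hf⟩)) h1

/-- Maximality argument. -/
lemma exists_maximal_values {k V : Type*} [Field k] [IsAlgClosed k]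
    [AddCommGroup V] [Module k V]
    (T : V →ₗ[k] V →ₗ[k] V →ₗ[k] k)
    (hT1 : ∀ x y z, T x y z = T y x z) (hT2 : ∀ x y z, T x y z = T x z y)
    (W U : Submodule k V) (hW : W.FG) (hU : U.CoFG) :
    ∃ (P : Submodule k (W →ₗ[k] k)) (F : Submodule k V), F.FG ∧ F ≤ U ∧
      (∀ α ∈ P, ∃ v ∈ F, T v v ∘ₗ W.subtype = α) ∧
      ∃ U₂ : Submodule k V, U₂.CoFG ∧ U₂ ≤ U ∧
        (∀ u ∈ U₂, ∀ f ∈ F, ∀ w ∈ W, T u f w = 0) ∧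
        ∀ u ∈ U₂, T u u ∘ₗ W.subtype ∈ P := by
  have : Module.Finite k W := Module.Finite.iff_fg.2 hW
  let S : Set (Submodule k (W →ₗ[k] k)) := {P | ∃ F : Submodule k V, F.FG ∧ F ≤ U ∧
      (∀ α ∈ P, ∃ v ∈ F, T v v ∘ₗ W.subtype = α)}
  have hS : S.Nonempty := by
    refine ⟨⊥, ⊥, Submodule.fg_bot, bot_le, fun α hα => ⟨0, Submodule.zero_mem _, ?_⟩⟩
    rw [(Submodule.mem_bot k).1 hα]; ext; simp
  obtain ⟨P, ⟨F, hF, hFU, hP⟩, hmax⟩ :=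
    set_has_maximal_iff_noetherian.2 (inferInstance : IsNoetherian k (W →ₗ[k] k)) S hS
  obtain ⟨U₁, hU₁, hperp⟩ := exists_perp T F W hF hW
  refine ⟨P, F, hF, hFU, hP, U ⊓ U₁, Submodule.CoFG.inf hU hU₁, inf_le_left,
    fun u hu f hf w hw => hperp u hu.2 f hf w hw, fun u hu => ?_⟩
  by_contra hnot
  refine hmax (P ⊔ Submodule.span k {T u u ∘ₗ W.subtype}) ?_ ?_
  · refine ⟨F ⊔ Submodule.span k {u}, hF.sup (Submodule.fg_span_singleton u),
      sup_le hFU ((Submodule.span_singleton_le_iff_mem _ _).2 hu.1), fun α hα => ?_⟩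
    obtain ⟨p, hp, y, hy, rfl⟩ := Submodule.mem_sup.1 hα
    obtain ⟨c, rfl⟩ := Submodule.mem_span_singleton.1 hy
    obtain ⟨v, hv, rfl⟩ := hP p hp
    obtain ⟨z, hz⟩ := IsAlgClosed.exists_pow_nat_eq c (n := 2) (by norm_num)
    refine ⟨v + z • u, Submodule.add_mem_sup hv
      (Submodule.smul_mem _ _ (Submodule.mem_span_singleton_self u)), ?_⟩
    ext w
    have h1 : T u v w = 0 := hperp u hu.2 v hv w w.2
    have h2 : T v u w = 0 := by rw [hT1]; exact h1
    simp [h1, h2, ← hz]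
    ring
  · refine lt_of_le_of_ne le_sup_left fun h => hnot ?_
    rw [h]
    exact Submodule.mem_sup_right (Submodule.mem_span_singleton_self _)

/-- A quadratic form vanishing on a finite-codimensional subspace has finite strength. -/
lemma finStrength_of_vanish {k V : Type*} [Field k] (hk2 : (2 : k) ≠ 0)
    [AddCommGroup V] [Module k V]
    (T : V →ₗ[k] V →ₗ[k] V →ₗ[k] k)
    (hT2 : ∀ x y z, T x y z = T x z y)
    (U : Submodule k V) (hU : U.CoFG) (w : V) (h : ∀ u ∈ U, T w u u = 0) :
    fQuad T w ∈ FinStrength k V := by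
  obtain ⟨C, hC⟩ := U.exists_isCompl
  have hCfg : C.FG := Submodule.CoFG.fg_of_isCompl hC hU
  have : Module.Finite k C := Module.Finite.iff_fg.2 hCfg
  let b := Module.finBasis k C
  let p : V →ₗ[k] C := Submodule.linearProjOfIsCompl C U hC.symm
  let pr : V →ₗ[k] V := C.subtype ∘ₗ p
  have hp : ∀ x, x - pr x ∈ U := by
    intro x
    rw [← Submodule.linearProjOfIsCompl_ker hC.symm, LinearMap.mem_ker, map_sub, sub_eq_zero]
    exact (Submodule.linearProjOfIsCompl_apply_left hC.symm (p x)).symm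
  refine ⟨Module.finrank k C, fun i => b.coord i ∘ₗ p,
    fun i => (3 : k) • ((T w (b i : V)) ∘ₗ ((2 : k) • LinearMap.id - pr)), fun x => ?_⟩
  have h1 := h _ (hp x)
  have h2 : pr x = ∑ i, b.coord i (p x) • (b i : V) := by
    have h6 : ((∑ i, b.repr (p x) i • b i : C) : V) = p x := by rw [b.sum_repr]
    rw [Submodule.coe_sum] at h6
    exact h6.symm
  have h3 : T w (pr x) ((2 : k) • x - pr x)
      = ∑ i, b.coord i (p x) * T w (b i : V) ((2 : k) • x - pr x) := by
    conv_lhs => rw [h2]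
    simp only [map_sum, LinearMap.sum_apply, map_smul, LinearMap.smul_apply, smul_eq_mul]
    rw [← h2]
  have h4 : T w x x = T w (pr x) ((2 : k) • x - pr x) := by
    have := hT2 w x (pr x)
    simp only [map_sub, LinearMap.sub_apply, map_smul, smul_eq_mul] at h1 ⊢
    linear_combination h1 + this
  have h5 : fQuad T w x = 3 * T w x x := by simp [fQuad]
  rw [h5, h4, h3, Finset.mul_sum]
  refine Finset.sum_congr rfl fun i _ => ?_
  simp only [LinearMap.comp_apply, LinearMap.smul_apply, LinearMap.sub_apply, LinearMap.id_apply,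
    smul_eq_mul]
  ring

/-- The map `v ↦ class of f_v`. -/
noncomputable def resMap {k V : Type*} [Field k] [AddCommGroup V] [Module k V]
    (T : V →ₗ[k] V →ₗ[k] V →ₗ[k] k) : V →ₗ[k] (QuadraticForm k V ⧸ FinStrength k V) :=
  (FinStrength k V).mkQ ∘ₗ
    { toFun := fQuad T
      map_add' := fun a b => by ext x; simp [fQuad, mul_add]
      map_smul' := fun c a => by ext x; simp [fQuad]; ring }

lemma mem_ker_resMap {k V : Type*} [Field k] [AddCommGroup V] [Module k V]
    (T : V →ₗ[k] V →ₗ[k] V →ₗ[k] k) (v : V) :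
    v ∈ LinearMap.ker (resMap T) ↔ fQuad T v ∈ FinStrength k V := by
  simp [resMap]

lemma not_cofg_ker {k V : Type*} [Field k] [AddCommGroup V] [Module k V]
    (T : V →ₗ[k] V →ₗ[k] V →ₗ[k] k) (h : Cardinal.aleph0 ≤ rrk k T) :
    ¬ (LinearMap.ker (resMap T)).CoFG := by
  intro hc
  have h1 := Submodule.range_fg_iff_ker_cofg.2 hc
  have h2 : Submodule.span k
    (Set.range fun v => Submodule.Quotient.mk (p := FinStrength k V) (fQuad T v))
      = LinearMap.range (resMap T) := by
    rw [show (Set.range fun v => Submodule.Quotient.mk (p := FinStrength k V) (fQuad T v))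
      = (LinearMap.range (resMap T) : Set _) from rfl, Submodule.span_eq]
  unfold rrk at h
  rw [h2] at h
  have : Module.Finite k (LinearMap.range (resMap T)) := Module.Finite.iff_fg.2 h1
  exact absurd (Module.rank_lt_aleph0 k (LinearMap.range (resMap T))) (not_lt.2 h)

lemma cofg_of_sup_fg {k V : Type*} [Field k] [AddCommGroup V] [Module k V]
    {N F : Submodule k V} (hF : F.FG) (h : (N ⊔ F).CoFG) : N.CoFG := by
  obtain ⟨C, hC⟩ := (N ⊔ F).exists_isCompl
  have hCfg : C.FG := Submodule.CoFG.fg_of_isCompl hC h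
  have hG : (F ⊔ C).FG := hF.sup hCfg
  have htop : Submodule.map N.mkQ (F ⊔ C) = ⊤ := by
    have : N ⊔ (F ⊔ C) = ⊤ := by rw [← sup_assoc]; exact hC.sup_eq_top
    have h2 := congrArg (Submodule.map N.mkQ) this
    rw [Submodule.map_sup] at h2
    simpa using h2
  exact ⟨htop ▸ hG.map N.mkQ⟩

/-- Solving quadratic equations. -/
lemma exists_solution {k V : Type*} [Field k] [IsAlgClosed k] (hk2 : (2 : k) ≠ 0)
    [AddCommGroup V] [Module k V]
    (T : V →ₗ[k] V →ₗ[k] V →ₗ[k] k)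
    (hT1 : ∀ x y z, T x y z = T y x z) (hT2 : ∀ x y z, T x y z = T x z y)
    (W U U' : Submodule k V) (hW : W.FG) (hU : U.CoFG) (hU' : ¬ U'.CoFG)
    (hd : Disjoint W (LinearMap.ker (resMap T))) (α : V →ₗ[k] k) :
    ∃ v ∈ U, v ∉ U' ∧ ∀ w ∈ W, T w v v = α w := by
  obtain ⟨P, F, hF, hFU, hP, U₂, hU₂, hle, hperp, hmem⟩ :=
    exists_maximal_values T hT1 hT2 W U hW hU
  have : Module.Finite k W := Module.Finite.iff_fg.2 hW
  have hsym : ∀ x y z, T x y z = T y z x := fun x y z => by rw [hT1, hT2]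
  have htop : P = ⊤ := by
    have hco : P.dualCoannihilator = ⊥ := by
      rw [eq_bot_iff]
      intro w hw
      rw [Submodule.mem_dualCoannihilator] at hw
      have h1 : (w : V) ∈ LinearMap.ker (resMap T) := by
        rw [mem_ker_resMap]
        refine finStrength_of_vanish hk2 T hT2 U₂ hU₂ w fun u hu => ?_
        have := hw _ (hmem u hu)
        rw [hsym]
        simpa using this
      have h2 := Submodule.disjoint_def.1 hd w w.2 h1
      exact (Submodule.mem_bot k).2 (Subtype.ext h2)
    have := Subspace.dualCoannihilator_dualAnnihilator_eq (W := P)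
    rw [← this, hco, Submodule.dualAnnihilator_bot]
  have : ¬ U₂ ≤ U' ⊔ F := fun h => hU' (cofg_of_sup_fg hF (Submodule.CoFG.of_le h hU₂))
  obtain ⟨u, hu, hu'⟩ := SetLike.not_le_iff_exists.1 this
  obtain ⟨v, hv, hvα⟩ := hP (α ∘ₗ W.subtype - T u u ∘ₗ W.subtype) (htop ▸ Submodule.mem_top)
  refine ⟨u + v, U.add_mem (hle hu) (hFU hv), fun h => hu' ?_, fun w hw => ?_⟩
  · have := Submodule.sub_mem _ (Submodule.mem_sup_left (T := F) h)
      (Submodule.mem_sup_right (S := U') hv)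
    simpa using this
  · have h1 : T u v w = 0 := hperp u hu v hv w hw
    have h2 : T v u w = 0 := by rw [hT1]; exact h1
    have h3 := congrArg (fun f => f ⟨w, hw⟩) hvα
    simp at h3
    rw [hsym]
    simp [h1, h2, h3]

lemma exists_cubic_root {k : Type*} [Field k] [IsAlgClosed k] (a b c d : k) (hc : c ≠ 0) :
    ∃ t : k, a + b * t + c * t ^ 2 + d * t ^ 3 = 0 := by
  let p : Polynomial k := Polynomial.C a + Polynomial.C b * Polynomial.X
    + Polynomial.C c * Polynomial.X ^ 2 + Polynomial.C d * Polynomial.X ^ 3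
  have hp : p.degree ≠ 0 := by
    intro h
    have h2 : p.coeff 2 = 0 := Polynomial.coeff_eq_zero_of_degree_lt (by rw [h]; norm_num)
    apply hc
    simpa [p, Polynomial.coeff_X, Polynomial.coeff_C, Polynomial.coeff_X_pow] using h2
  obtain ⟨t, ht⟩ := IsAlgClosed.exists_root p hp
  exact ⟨t, by simpa [p, Polynomial.IsRoot] using ht⟩

lemma disjoint_sup_span {k V : Type*} [Field k] [AddCommGroup V] [Module k V]
    {W N : Submodule k V} (hd : Disjoint W N) {v : V} (hv : v ∉ W ⊔ N) :
    Disjoint (W ⊔ Submodule.span k {v}) N := by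
  rw [Submodule.disjoint_def] at hd ⊢
  intro x hx hxN
  obtain ⟨w, hw, y, hy, rfl⟩ := Submodule.mem_sup.1 hx
  obtain ⟨c, rfl⟩ := Submodule.mem_span_singleton.1 hy
  by_cases hc : c = 0
  · subst hc
    simp at hxN ⊢
    exact hd w hw hxN
  · exfalso
    apply hv
    have h1 : c • v ∈ W ⊔ N := by
      have := Submodule.sub_mem _ (Submodule.mem_sup_right (S := W) hxN)
        (Submodule.mem_sup_left (T := N) hw)
      simpa using this
    exact (Submodule.smul_mem_iff _ hc).1 h1

/-- One step of the construction. -/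
lemma exists_step {k V : Type*} [Field k] [IsAlgClosed k] (hk2 : (2 : k) ≠ 0)
    (hk3 : (3 : k) ≠ 0) [AddCommGroup V] [Module k V]
    (T : V →ₗ[k] V →ₗ[k] V →ₗ[k] k)
    (hT1 : ∀ x y z, T x y z = T y x z) (hT2 : ∀ x y z, T x y z = T x z y)
    (hN : ¬ (LinearMap.ker (resMap T)).CoFG)
    (W : Submodule k V) (hW : W.FG)
    (hd : Disjoint W (LinearMap.ker (resMap T))) (α : V →ₗ[k] k) :
    ∃ v, v ∉ W ⊔ LinearMap.ker (resMap T) ∧ (∀ w ∈ W, ∀ w' ∈ W, T v w w' = 0) ∧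
      (∀ w ∈ W, T w v v = α w) ∧ T v v v = 0 := by
  have hns : ∀ W' : Submodule k V, W'.FG → ¬ (W' ⊔ LinearMap.ker (resMap T)).CoFG := by
    intro W' hW' h
    rw [sup_comm] at h
    exact hN (cofg_of_sup_fg hW' h)
  obtain ⟨U, hU, hUp⟩ := exists_perp T W W hW hW
  obtain ⟨v0, hv0U, hv0, hv0α⟩ := exists_solution hk2 T hT1 hT2 W U _ hW hU (hns W hW) hd α
  have hv0W : v0 ∉ W := fun h => hv0 (Submodule.mem_sup_left h)
  obtain ⟨f, hf0, hfW⟩ := Submodule.exists_le_ker_of_notMem hv0W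
  let W1 := W ⊔ Submodule.span k {v0}
  have hW1 : W1.FG := hW.sup (Submodule.fg_span_singleton v0)
  have hv0W1 : v0 ∈ W1 := Submodule.mem_sup_right (Submodule.mem_span_singleton_self v0)
  have hWW1 : W ≤ W1 := le_sup_left
  obtain ⟨U1, hU1, hU1p⟩ := exists_perp T W1 W1 hW1 hW1
  obtain ⟨v1, hv1U, hv1, hv1α⟩ := exists_solution hk2 T hT1 hT2 W1 U1 _ hW1 hU1 (hns W1 hW1)
    (disjoint_sup_span hd hv0) f
  have hc : 3 * T v0 v1 v1 ≠ 0 := by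
    rw [hv1α v0 hv0W1]; exact mul_ne_zero hk3 hf0
  obtain ⟨t, ht⟩ := exists_cubic_root (T v0 v0 v0) (3 * T v0 v0 v1) _ (T v1 v1 v1) hc
  refine ⟨v0 + t • v1, fun h => ?_, fun w hw w' hw' => ?_, fun w hw => ?_, ?_⟩
  · by_cases ht0 : t = 0
    · subst ht0
      simp at h
      exact hv0 h
    · apply hv1
      have hle : W ⊔ LinearMap.ker (resMap T) ≤ W1 ⊔ LinearMap.ker (resMap T) :=
        sup_le_sup_right hWW1 _
      have h1 := Submodule.sub_mem _ (hle h) (Submodule.mem_sup_left hv0W1)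
      rw [add_sub_cancel_left] at h1
      exact (Submodule.smul_mem_iff _ ht0).1 h1
  · simp [hUp v0 hv0U w hw w' hw', hU1p v1 hv1U w (hWW1 hw) w' (hWW1 hw')]
  · have h1 : T w v1 v1 = 0 := by
      rw [hv1α w (hWW1 hw)]; exact hfW hw
    have h2 : T w v1 v0 = 0 := by
      rw [hT1]; exact hU1p v1 hv1U w (hWW1 hw) v0 hv0W1
    have h3 : T w v0 v1 = 0 := by rw [hT2]; exact h2
    simp [h1, h2, h3, hv0α w hw]
  · have h1 : T v0 v1 v0 = T v0 v0 v1 := hT2 _ _ _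
    have h2 : T v1 v0 v0 = T v0 v0 v1 := by rw [hT1, h1]
    have h3 : T v1 v0 v1 = T v0 v1 v1 := hT1 _ _ _
    have h4 : T v1 v1 v0 = T v0 v1 v1 := by rw [hT2, h3]
    simp only [map_add, LinearMap.add_apply, map_smul, LinearMap.smul_apply, smul_eq_mul,
      h1, h2, h3, h4]
    linear_combination ht

/-- Dependent choice of a sequence. -/
lemma exists_seq_step {V : Type*} [Inhabited V] (P : ℕ → (ℕ → V) → V → Prop)
    (loc : ∀ n g g' x, (∀ m < n, g m = g' m) → P n g x → P n g' x)
    (step : ∀ n g, (∀ m < n, P m g (g m)) → ∃ x, P n g x) :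
    ∃ g : ℕ → V, ∀ n, P n g (g n) := by
  classical
  choose! X hX using step
  let st : ℕ → (ℕ → V) := fun n => Nat.rec (fun _ => default)
    (fun n g => Function.update g n (X n g)) n
  have hst : ∀ n, st (n + 1) = Function.update (st n) n (X n (st n)) := fun n => rfl
  have hstab : ∀ n m, m < n → st n m = st (m + 1) m := by
    intro n
    induction n with
    | zero => intro m hm; omega
    | succ n ih =>
      intro m hm
      rcases Nat.lt_succ_iff_lt_or_eq.1 hm with h | h
      · rw [hst, Function.update_of_ne h.ne, ih m h]
      · rw [h]
  let g : ℕ → V := fun n => st (n + 1) n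
  have hg : ∀ n m, m < n → st n m = g m := hstab
  refine ⟨g, fun n => ?_⟩
  induction n using Nat.strong_induction_on with
  | _ n ih =>
    have h1 : P n (st n) (X n (st n)) := by
      apply hX
      intro m hm
      rw [hg n m hm]
      exact loc m g (st n) _ (fun l hl => (hg n l (hl.trans hm)).symm) (ih m hm)
    have h2 : g n = X n (st n) := by
      change st (n + 1) n = _
      rw [hst, Function.update_self]
    rw [h2]
    exact loc n (st n) g _ (fun m hm => hg n m hm) h1

lemma image_lt_succ {V : Type*} (g : ℕ → V) (n : ℕ) :
    g '' {m | m < n + 1} = g '' {m | m < n} ∪ {g n} := by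
  ext x
  simp only [Set.mem_image, Set.mem_ofPred_eq, Set.mem_union, Set.mem_singleton_iff]
  constructor
  · rintro ⟨m, hm, rfl⟩
    rcases Nat.lt_succ_iff_lt_or_eq.1 hm with h | h
    · exact Or.inl ⟨m, h, rfl⟩
    · exact Or.inr (by rw [h])
  · rintro (⟨m, hm, rfl⟩ | rfl)
    · exact ⟨m, by omega, rfl⟩
    · exact ⟨n, by omega, rfl⟩

lemma exists_functional {k V : Type*} [Field k] [AddCommGroup V] [Module k V]
    (g : ℕ → V) (a : ℕ → k) (n : ℕ)
    (h : ∀ m < n, g m ∉ Submodule.span k (g '' {l | l < m})) :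
    ∃ α : V →ₗ[k] k, ∀ m < n, α (g m) = a m := by
  induction n with
  | zero => exact ⟨0, fun m hm => by omega⟩
  | succ n ih =>
    obtain ⟨α, hα⟩ := ih fun m hm => h m (by omega)
    obtain ⟨f, hf0, hf⟩ := Submodule.exists_le_ker_of_notMem (h n (by omega))
    refine ⟨α + ((a n - α (g n)) * (f (g n))⁻¹) • f, fun m hm => ?_⟩
    rcases Nat.lt_succ_iff_lt_or_eq.1 hm with hm | rfl
    · have : f (g m) = 0 := hf (Submodule.subset_span ⟨m, hm, rfl⟩)
      simp [this, hα m hm]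
    · simp [mul_assoc, inv_mul_cancel₀ hf0]

lemma exists_good_seq {k V : Type*} [Field k] [IsAlgClosed k] (hk2 : (2 : k) ≠ 0)
    (hk3 : (3 : k) ≠ 0) [AddCommGroup V] [Module k V]
    (T : V →ₗ[k] V →ₗ[k] V →ₗ[k] k)
    (hT1 : ∀ x y z, T x y z = T y x z) (hT2 : ∀ x y z, T x y z = T x z y)
    (hN : ¬ (LinearMap.ker (resMap T)).CoFG) (a : ℕ → ℕ → k) :
    ∃ g : ℕ → V, ∀ n, (∀ l < n, ∀ m < n, T (g n) (g l) (g m) = 0) ∧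
      (∀ m < n, T (g m) (g n) (g n) = a n m) ∧ T (g n) (g n) (g n) = 0 := by
  have : Inhabited V := ⟨0⟩
  let N := LinearMap.ker (resMap T)
  let P : ℕ → (ℕ → V) → V → Prop := fun n g x =>
    x ∉ Submodule.span k (g '' {l | l < n}) ⊔ N ∧
    (∀ l < n, ∀ m < n, T x (g l) (g m) = 0) ∧
      (∀ m < n, T (g m) x x = a n m) ∧ T x x x = 0
  suffices hs : ∃ g : ℕ → V, ∀ n, P n g (g n) by
    obtain ⟨g, hg⟩ := hs
    exact ⟨g, fun n => (hg n).2⟩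
  apply exists_seq_step
  · rintro n g g' x hgg ⟨h1, h2, h3, h4⟩
    have himg : g '' {l | l < n} = g' '' {l | l < n} := Set.image_congr hgg
    refine ⟨himg ▸ h1, fun l hl m hm => ?_, fun m hm => ?_, h4⟩
    · rw [← hgg l hl, ← hgg m hm]; exact h2 l hl m hm
    · rw [← hgg m hm]; exact h3 m hm
  · intro n g hprev
    have hd : ∀ m ≤ n, Disjoint (Submodule.span k (g '' {l | l < m})) N := by
      intro m
      induction m with
      | zero => intro _; simp
      | succ m ih =>
        intro hm
        rw [image_lt_succ, Submodule.span_union]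
        exact disjoint_sup_span (ih (by omega)) (hprev m (by omega)).1
    obtain ⟨α, hα⟩ := exists_functional g (a n) n
      fun m hm h => (hprev m hm).1 (Submodule.mem_sup_left h)
    have hfg : (Submodule.span k (g '' {l | l < n})).FG :=
      Submodule.fg_span ((Set.finite_lt_nat n).image g)
    have hmem : ∀ m < n, g m ∈ Submodule.span k (g '' {l | l < n}) :=
      fun m hm => Submodule.subset_span ⟨m, hm, rfl⟩
    obtain ⟨v, h1, h2, h3, h4⟩ := exists_step hk2 hk3 T hT1 hT2 hN _ hfg (hd n le_rfl) α
    exact ⟨v, h1, fun l hl m hm => h2 _ (hmem l hl) _ (hmem m hm),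
      fun m hm => (h3 _ (hmem m hm)).trans (hα m hm), h4⟩

/-- Code of basis vectors by natural numbers. -/
def codeInf : ℕ ⊕ ℕ × ℕ → ℕ
  | Sum.inl i => 2 * i
  | Sum.inr p => 2 * Nat.pair p.1 p.2 + 1

lemma codeInf_injective : Function.Injective codeInf := by
  rintro (i | ⟨i, j⟩) (i' | ⟨i', j'⟩) h <;> simp only [codeInf] at h
  · congr 1; omega
  · omega
  · omega
  · have : Nat.pair i j = Nat.pair i' j' := by omega
    rw [Nat.pair_eq_pair] at this
    rw [this.1, this.2]

open Classical in
/-- Prescribed values. -/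
noncomputable def aInf (k : Type*) [Field k] (n m : ℕ) : k :=
  if ∃ i j, n = codeInf (Sum.inr (i, j)) ∧ m = codeInf (Sum.inl i) then 1 else 0

lemma aInf_eq_zero (k : Type*) [Field k] {n m : ℕ} (h : n ≤ m) : aInf k n m = 0 := by
  unfold aInf
  rw [if_neg]
  rintro ⟨i, j, rfl, rfl⟩
  simp only [codeInf] at h
  have := Nat.left_le_pair i j
  omega

lemma gInf_eq (k : Type*) [Field k] (u v w : ℕ ⊕ ℕ × ℕ) :
    gInf k u v w = if codeInf v = codeInf w then aInf k (codeInf v) (codeInf u) else 0 := by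
  have ha : aInf k (codeInf v) (codeInf u)
      = open Classical in if ∃ i j, v = Sum.inr (i, j) ∧ u = Sum.inl i then (1 : k) else 0 := by
    unfold aInf
    congr 1
    simp only [codeInf_injective.eq_iff]
  rw [ha]
  simp only [codeInf_injective.eq_iff]
  rcases u with i | p <;> rcases v with i' | p' <;> rcases w with i'' | p'' <;> simp [gInf]
  rw [← ite_and]
  congr 1
  apply propext
  constructor
  · rintro ⟨rfl, rfl⟩; exact ⟨rfl, p'.1, p'.2, rfl, rfl⟩
  · rintro ⟨rfl, i₁, j, h1, h2⟩
    cases h1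
    cases h2
    exact ⟨rfl, rfl⟩

lemma seq_tri {k V : Type*} [Field k] [AddCommGroup V] [Module k V]
    (T : V →ₗ[k] V →ₗ[k] V →ₗ[k] k)
    (hT1 : ∀ x y z, T x y z = T y x z) (hT2 : ∀ x y z, T x y z = T x z y)
    (a : ℕ → ℕ → k) (ha : ∀ n m, n ≤ m → a n m = 0) (g : ℕ → V)
    (hg : ∀ n, (∀ l < n, ∀ m < n, T (g n) (g l) (g m) = 0) ∧
      (∀ m < n, T (g m) (g n) (g n) = a n m) ∧ T (g n) (g n) (g n) = 0) (l m n : ℕ) :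
    T (g l) (g m) (g n) = (if m = n then a m l else 0) + (if l = n then a l m else 0)
      + (if l = m then a l n else 0) := by
  have key : ∀ l m n, l ≤ m → m ≤ n → T (g l) (g m) (g n) =
      (if m = n then a m l else 0) + (if l = n then a l m else 0)
      + (if l = m then a l n else 0) := by
    intro l m n hlm hmn
    have e3 : (if l = m then a l n else 0) = 0 := by
      split_ifs
      · exact ha _ _ (by omega)
      · rfl
    have e2 : (if l = n then a l m else 0) = 0 := by
      split_ifs
      · exact ha _ _ (by omega)
      · rfl
    rw [e3, e2, add_zero, add_zero]
    rcases hmn.lt_or_eq with h | rfl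
    · rw [if_neg h.ne, hT2, hT1]
      exact (hg n).1 l (by omega) m h
    · rw [if_pos rfl]
      rcases hlm.lt_or_eq with h | rfl
      · exact (hg m).2.1 l h
      · rw [(hg l).2.2, ha _ _ le_rfl]
  have s1 : ∀ x y z, T x y z = T z x y := fun x y z => by rw [hT2, hT1]
  have s2 : ∀ x y z, T x y z = T y z x := fun x y z => by rw [hT1, hT2]
  have s3 : ∀ x y z, T x y z = T z y x := fun x y z => by rw [hT1, hT2, hT1]
  rcases le_total l m with h1 | h1 <;> rcases le_total m n with h2 | h2 <;>
    rcases le_total l n with h3 | h3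
  · exact key l m n h1 h2
  · exact key l m n h1 h2
  · rw [hT2, key l n m h3 h2]; grind
  · rw [s1, key n l m h3 h1]; grind
  · rw [hT1, key m l n h1 h3]; grind
  · rw [s2, key m n l h2 h3]; grind
  · rw [s3, key n m l h2 h1]; grind
  · rw [s3, key n m l h2 h1]; grind

lemma triBasis_single (k : Type*) [Field k] {ι : Type*} (c : ι → ι → ι → k) (u v w : ι) :
    triBasis k c (Finsupp.single u 1) (Finsupp.single v 1) (Finsupp.single w 1) = c u v w := by
  simp [triBasis]

/-- Lemma 4.6 of the paper. If a cubic space `(V,T)` has infinite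
residual rank, then `V(∞)` embeds into it. -/
theorem VInf_embeds_of_infinite_rrk
    {k V : Type*} [Field k] [IsAlgClosed k]
    (hk2 : (2 : k) ≠ 0) (hk3 : (3 : k) ≠ 0)
    [AddCommGroup V] [Module k V]
    (T : V →ₗ[k] V →ₗ[k] V →ₗ[k] k)
    (hT1 : ∀ x y z, T x y z = T y x z) (hT2 : ∀ x y z, T x y z = T x z y)
    (hVrrk : Cardinal.aleph0 ≤ rrk k T) :
    ∃ φ : VInf k →ₗ[k] V, ∀ x y z, T (φ x) (φ y) (φ z) = TInf k x y z := by
  obtain ⟨g, hg⟩ := exists_good_seq hk2 hk3 T hT1 hT2 (not_cofg_ker T hVrrk) (aInf k)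
  let ψ : ((ℕ ⊕ ℕ × ℕ) →₀ k) →ₗ[k] V := Finsupp.linearCombination k (fun u => g (codeInf u))
  have hψ : comp3 T ψ = triBasis k (cInf k) := by
    ext u v w
    simp only [LinearMap.comp_apply, Finsupp.lsingle_apply]
    rw [triBasis_single]
    simp only [comp3, LinearMap.coe_mk, AddHom.coe_mk, LinearMap.compl₁₂_apply, ψ,
      Finsupp.linearCombination_single, one_smul]
    rw [seq_tri T hT1 hT2 (aInf k) (fun n m h => aInf_eq_zero k h) g hg, cInf,
      gInf_eq, gInf_eq, gInf_eq]
  refine ⟨ψ ∘ₗ eInf k, fun x y z => ?_⟩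
  have h := congrArg (fun S => S (eInf k x) (eInf k y) (eInf k z)) hψ
  simpa [comp3, TInf] using h
end

section
/- Let r ∈ ℕ and let (V,T) be a non-degenerate cubic space over k with rrk(V,T) = r. Then every cubic space (W,S) over k with dim_k W ≤ ℵ₀ and rrk(W,S) ≤ r admits an embedding of cubic spaces W → V. -/
open scoped BigOperators

namespace CubicEmb

section VSide

variable {k V : Type*} [Field k] [AddCommGroup V] [Module k V]

/-- A finite-codimensional subspace admits a projection with finite rank complement. -/
lemma exists_proj (U : Submodule k V) (hU : U.CoFG) :
    ∃ (P : V →ₗ[k] V) (n : ℕ) (l : Fin n → V →ₗ[k] k) (c : Fin n → V),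
      (∀ v, P v ∈ U) ∧ ∀ v, v = P v + ∑ i, l i v • c i := by
  obtain ⟨C, hC⟩ := U.exists_isCompl
  have hfg : C.FG := Submodule.CoFG.fg_of_isCompl hC hU
  have : Module.Finite k C := Module.Finite.of_fg hfg
  let b := Module.finBasis k C
  let pC := Submodule.projectionOnto C U hC.symm
  let pU := Submodule.projectionOnto U C hC
  refine ⟨U.subtype ∘ₗ pU, _, fun i => b.coord i ∘ₗ pC, fun i => (b i : V), fun v => (pU v).2, ?_⟩
  intro v
  have h1 : ∑ i, (b.coord i ∘ₗ pC) v • (b i : V) = (pC v : V) := by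
    conv_rhs => rw [← b.sum_repr (pC v)]
    simp [-Module.Basis.sum_repr]
  rw [h1]
  have := Submodule.projection_add_projection_eq_self hC v
  exact this.symm

/-- A family of linear maps with cofinite kernels has cofinite common kernel over an FG module. -/
lemma exists_cofg {X M' : Type*} [AddCommGroup X] [Module k X] [AddCommGroup M'] [Module k M']
    (g : M' →ₗ[k] V →ₗ[k] X)
    (M : Submodule k M') (hM : M.FG) (h : ∀ m ∈ M, (LinearMap.ker (g m)).CoFG) :
    ∃ U : Submodule k V, U.CoFG ∧ ∀ u ∈ U, ∀ m ∈ M, g m u = 0 := by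
  classical
  obtain ⟨s, rfl⟩ := hM
  refine ⟨sInf ((s.image fun m => LinearMap.ker (g m) : Finset (Submodule k V))), ?_, ?_⟩
  · apply Submodule.CoFG.sInf
    intro S hS
    obtain ⟨m, hm, rfl⟩ := Finset.mem_image.1 hS
    exact h m (Submodule.subset_span hm)
  · intro u hu m hm
    have : Submodule.span k (s : Set M') ≤ LinearMap.ker (g.flip u) := by
      rw [Submodule.span_le]
      intro m hm
      have := (Submodule.mem_sInf.1 hu) (LinearMap.ker (g m))
        (by exact_mod_cast Finset.mem_image_of_mem _ hm)
      simpa using this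
    simpa using this hm

variable (T : V →ₗ[k] V →ₗ[k] V →ₗ[k] k)

/-- Non-degenerate cubic forms do not vanish on cofinite subspaces. -/
lemma exists_cubic_ne (hV : ¬ FiniteStrengthCubic k T) (U : Submodule k V) (hU : U.CoFG) :
    ∃ u ∈ U, T u u u ≠ 0 := by
  by_contra! hcon
  obtain ⟨P, n, l, c, hP, hv⟩ := exists_proj U hU
  apply hV
  refine ⟨n, l, fun i => LinearMap.BilinMap.toQuadraticMap
    (T (c i) + (T.flip (c i)) ∘ₗ P +
      ((LinearMap.compl₁₂ (T.compr₂ (LinearMap.applyₗ (c i))) P P))), ?_⟩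
  intro x
  have h0 := hcon (P x) (hP x)
  have e1 : T x x x = T (x - P x) x x + T (P x) (x - P x) x + T (P x) (P x) (x - P x)
      + T (P x) (P x) (P x) := by simp
  have e2 : x - P x = ∑ i, l i x • c i := by
    exact sub_eq_of_eq_add' (hv x)
  rw [e1, h0, e2]
  simp [mul_add, Finset.sum_add_distrib]

lemma exists_quad_ne (B : V →ₗ[k] V →ₗ[k] k)
    (hV : LinearMap.BilinMap.toQuadraticMap B ∉ FinStrength k V) (U : Submodule k V)
    (hU : U.CoFG) :
    ∃ u ∈ U, B u u ≠ 0 := by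
  by_contra! hcon
  obtain ⟨P, n, l, c, hP, hv⟩ := exists_proj U hU
  apply hV
  refine ⟨n, l, fun i => B (c i) ∘ₗ .id + (B.flip (c i)) ∘ₗ P, ?_⟩
  intro x
  have h0 := hcon (P x) (hP x)
  have e1 : B x x = B (x - P x) x + B (P x) (x - P x) + B (P x) (P x) := by simp
  have e2 : x - P x = ∑ i, l i x • c i := by
    exact sub_eq_of_eq_add' (hv x)
  rw [LinearMap.BilinMap.toQuadraticMap_apply, e1, h0, e2]
  simp [mul_add, Finset.sum_add_distrib]

lemma ker_cofg_of_finStrength (hk2 : (2 : k) ≠ 0) (B : V →ₗ[k] V →ₗ[k] k)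
    (hB : ∀ x y, B x y = B y x) (n : ℕ) (l m : Fin n → V →ₗ[k] k)
    (h : ∀ x, B x x = ∑ i, l i x * m i x) :
    (LinearMap.ker B).CoFG := by
  have : (LinearMap.ker (LinearMap.pi l) ⊓ LinearMap.ker (LinearMap.pi m)).CoFG :=
    Submodule.CoFG.inf (Submodule.CoFG.ker _) (Submodule.CoFG.ker _)
  refine Submodule.CoFG.of_le ?_ this
  intro x hx
  have hl : ∀ i, l i x = 0 := fun i => congrFun hx.1 i
  have hm : ∀ i, m i x = 0 := fun i => congrFun hx.2 i
  rw [LinearMap.mem_ker]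
  ext y
  have h1 := h (x + y)
  have h2 := h x
  have h3 := h y
  simp only [map_add, LinearMap.add_apply, hl, hm, zero_add, mul_zero, Finset.sum_const_zero]
    at h1 h2
  rw [hB y x, h2, ← h3] at h1
  have : 2 * B x y = 0 := by linear_combination h1
  simpa [hk2] using this

/-- The properties of `(V,T)` used in the construction. -/
structure Setup (T : V →ₗ[k] V →ₗ[k] V →ₗ[k] k) (r : ℕ) (e : Fin r → V)
    (V₀ : Submodule k V) : Prop where
  s1 : ∀ x y z, T x y z = T y x z
  s2 : ∀ x y z, T x y z = T x z y
  cof : V₀.CoFG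
  kerc : ∀ v ∈ V₀, (LinearMap.ker (T v)).CoFG
  quad : ∀ c : Fin r → k, c ≠ 0 → ∀ U : Submodule k V, U.CoFG →
    ∃ u ∈ U, ∑ a, c a * T (e a) u u ≠ 0
  cub : ∀ U : Submodule k V, U.CoFG → ∃ u ∈ U, T u u u ≠ 0

variable {T} {r : ℕ} {e : Fin r → V} {V₀ : Submodule k V}

/-- vectors orthogonal to `z` -/
lemma Setup.orth (h : Setup T r e V₀) (z : V) (hz : z ∈ V₀) (U : Submodule k V) (hU : U.CoFG) :
    ∃ U' : Submodule k V, U'.CoFG ∧ U' ≤ U ∧ (∀ u ∈ U', T z u = 0) ∧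
      ∀ u ∈ U', ∀ a, T (e a) z u = 0 := by
  refine ⟨U ⊓ (LinearMap.ker (T z) ⊓ LinearMap.ker (LinearMap.pi fun a => T (e a) z)),
    hU.inf ((h.kerc z hz).inf (Submodule.CoFG.ker _)), inf_le_left, fun u hu => hu.2.1,
    fun u hu a => congrFun hu.2.2 a⟩

lemma Setup.A1 [IsAlgClosed k] (hk2 : (2 : k) ≠ 0) (h : Setup T r e V₀) (A : Finset (Fin r)) :
    ∀ U : Submodule k V, U.CoFG → ∃ z ∈ U, T z z z ≠ 0 ∧ ∀ a ∈ A, T (e a) z z = 0 := by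
  classical
  induction A using Finset.induction_on with
  | empty =>
    intro U hU
    obtain ⟨u, hu, h1⟩ := h.cub U hU
    exact ⟨u, hu, h1, by simp⟩
  | insert a A ha ih =>
    intro U hU
    obtain ⟨z, ⟨hzU, hz0⟩, hz1, hzA⟩ := ih (U ⊓ V₀) (hU.inf h.cof)
    obtain ⟨U', hU', hle, ho1, ho2⟩ := h.orth z hz0 U hU
    obtain ⟨y, hy, hy1, hyA⟩ := ih U' hU'
    by_cases hza : T (e a) z z = 0
    · exact ⟨z, hzU, hz1, by simp [hza]; exact hzA⟩
    by_cases hya : T (e a) y y = 0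
    · exact ⟨y, hle hy, hy1, by simp [hya]; exact hyA⟩
    obtain ⟨t, ht⟩ := IsAlgClosed.exists_pow_nat_eq (-(T (e a) z z) / T (e a) y y)
      (n := 2) (by norm_num)
    have o1 : T z y = 0 := ho1 y hy
    have o1' : T y z = 0 := by ext w; rw [h.s1, o1]
    have o2 : ∀ b, T (e b) z y = 0 := ho2 y hy
    have o2' : ∀ b, T (e b) y z = 0 := fun b => by rw [h.s2, o2]
    have o3 : T z z y = 0 := by rw [h.s2, o1]; rfl
    have o4 : T y y z = 0 := by rw [h.s2, o1']; rfl
    have key : ∀ s : k, s ^ 2 = -(T (e a) z z) / T (e a) y y →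
        (z + s • y) ∈ U ∧ T (z + s • y) (z + s • y) (z + s • y) = T z z z + s ^ 3 * T y y y ∧
        ∀ b ∈ insert a A, T (e b) (z + s • y) (z + s • y) = 0 := by
      intro s hs
      refine ⟨U.add_mem hzU (U.smul_mem _ (hle hy)), ?_, ?_⟩
      · simp [o1, o1', o3, o4]; ring
      · intro b hb
        have : T (e b) (z + s • y) (z + s • y) = T (e b) z z + s ^ 2 * T (e b) y y := by
          simp [o2, o2']; ring
        rw [this]
        rcases Finset.mem_insert.1 hb with rfl | hb
        · rw [hs]; field_simp; ring
        · rw [hzA b hb, hyA b hb]; simp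
    obtain ⟨k1, k2, k3⟩ := key t ht
    obtain ⟨l1, l2, l3⟩ := key (-t) (by rw [neg_sq, ht])
    by_cases hc : T z z z + t ^ 3 * T y y y = 0
    · refine ⟨_, l1, ?_, l3⟩
      rw [l2]
      intro hc'
      have : 2 * T z z z = 0 := by linear_combination hc + hc'
      simp [hk2, hz1] at this
    · exact ⟨_, k1, by rwa [k2], k3⟩

lemma Setup.A2 [IsAlgClosed k] (h : Setup T r e V₀) (U : Submodule k V) (hU : U.CoFG)
    (d : Fin r → k) : ∃ u ∈ U, ∀ a, T (e a) u u = d a := by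
  let Q : Submodule k (Fin r → k) → Prop := fun L => ∃ M : Submodule k V, M.FG ∧ M ≤ U ∧
    ∀ d ∈ L, ∃ u ∈ M, ∀ a, T (e a) u u = d a
  have hbot : Q ⊥ := by
    refine ⟨⊥, Submodule.fg_bot, bot_le, ?_⟩
    intro d hd
    rw [Submodule.mem_bot] at hd
    exact ⟨0, by simp, by simp [hd]⟩
  obtain ⟨L, ⟨M, hM, hMU, hL⟩, hmax⟩ :=
    WellFounded.has_min (wellFounded_gt (α := Submodule k (Fin r → k))) {L | Q L} ⟨⊥, hbot⟩
  by_cases hLt : L = ⊤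
  · obtain ⟨u, hu, hud⟩ := hL d (by simp [hLt])
    exact ⟨u, hMU hu, hud⟩
  exfalso
  obtain ⟨f, hf0, hfL⟩ := Submodule.exists_le_ker_of_lt_top L (lt_top_iff_ne_top.2 hLt)
  have hfe : ∀ d : Fin r → k, f d = ∑ a, f (Pi.single a 1) * d a := by
    intro d
    conv_lhs => rw [← LinearMap.sum_single_apply (fun _ => k) d, map_sum]
    refine Finset.sum_congr rfl fun a _ => ?_
    have : (Pi.single a (d a) : Fin r → k) = d a • Pi.single a 1 := by
      rw [← Pi.single_smul]; simp
    simp [this, mul_comm]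
  obtain ⟨U', hU', ho⟩ := exists_cofg (k := k) (V := V) (X := Fin r → k)
    (LinearMap.mk₂ k (fun m u a => T (e a) m u) (by intros; ext; simp) (by intros; ext; simp)
        (by intros; ext; simp) (by intros; ext; simp)) M hM
    (fun m _ => Submodule.CoFG.ker _)
  obtain ⟨u, ⟨huU, huU'⟩, hu⟩ := h.quad (fun a => f (Pi.single a 1))
    (by
      intro h0; apply hf0
      refine LinearMap.ext fun d => ?_
      rw [hfe d]
      exact Finset.sum_eq_zero fun a _ => by simp [congrFun h0 a]) (U ⊓ U') (hU.inf hU')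
  rw [← hfe (fun a => T (e a) u u)] at hu
  refine hmax (L ⊔ Submodule.span k {fun a => T (e a) u u})
    ⟨M ⊔ Submodule.span k {u}, hM.sup (Submodule.fg_span_singleton u), sup_le hMU ?_, ?_⟩ ?_
  · simpa using huU
  · intro d hd
    obtain ⟨d₁, hd₁, d₂, hd₂, rfl⟩ := Submodule.mem_sup.1 hd
    obtain ⟨s, rfl⟩ := Submodule.mem_span_singleton.1 hd₂
    obtain ⟨t, ht⟩ := IsAlgClosed.exists_pow_nat_eq s (n := 2) (by norm_num)
    obtain ⟨m, hm, hmd⟩ := hL d₁ hd₁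
    refine ⟨m + t • u, Submodule.add_mem_sup hm
      (Submodule.smul_mem _ _ (Submodule.mem_span_singleton_self u)), fun a => ?_⟩
    have o : T (e a) m u = 0 := congrFun (ho u huU' m hm) a
    have o' : T (e a) u m = 0 := by rw [h.s2, o]
    simp [o, o', hmd, ← ht]; ring
  · refine lt_of_le_of_ne le_sup_left ?_
    intro heq
    apply hu
    apply hfL
    rw [heq]
    exact Submodule.mem_sup_right (Submodule.mem_span_singleton_self _)

lemma Setup.A [IsAlgClosed k] (hk2 : (2 : k) ≠ 0) (h : Setup T r e V₀) (U : Submodule k V)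
    (hU : U.CoFG) (c : k) (d : Fin r → k) :
    ∃ u ∈ U, T u u u = c ∧ ∀ a, T (e a) u u = d a := by
  obtain ⟨z, ⟨hzU, hz0⟩, hz1⟩ := h.A2 (U ⊓ V₀) (hU.inf h.cof) d
  obtain ⟨U', hU', hle, ho1, ho2⟩ := h.orth z hz0 U hU
  obtain ⟨y, hy, hy1, hyA⟩ := h.A1 hk2 Finset.univ U' hU'
  obtain ⟨t, ht⟩ := IsAlgClosed.exists_pow_nat_eq ((c - T z z z) / T y y y)
    (n := 3) (by norm_num)
  have o1 : T z y = 0 := ho1 y hy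
  have o1' : T y z = 0 := by ext w; rw [h.s1, o1]
  have o2 : ∀ b, T (e b) z y = 0 := ho2 y hy
  have o2' : ∀ b, T (e b) y z = 0 := fun b => by rw [h.s2, o2]
  have o3 : T z z y = 0 := by rw [h.s2, o1]; rfl
  have o4 : T y y z = 0 := by rw [h.s2, o1']; rfl
  refine ⟨z + t • y, U.add_mem hzU (U.smul_mem _ (hle hy)), ?_, fun a => ?_⟩
  · have : T (z + t • y) (z + t • y) (z + t • y) = T z z z + t ^ 3 * T y y y := by
      simp [o1, o1', o3, o4]; ring
    rw [this, ht]; field_simp; ring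
  · simp [o2, o2', hz1, hyA a (Finset.mem_univ a)]

end VSide

section Poly

variable {k W : Type*} [Field k] [AddCommGroup W] [Module k W]

/-- Polarization identity. -/
lemma polar_id (D : W →ₗ[k] W →ₗ[k] W →ₗ[k] k)
    (h1 : ∀ x y z, D x y z = D y x z) (h2 : ∀ x y z, D x y z = D x z y) (x y z : W) :
    6 * D x y z = D (x + y + z) (x + y + z) (x + y + z) - D (x + y) (x + y) (x + y)
      - D (x + z) (x + z) (x + z) - D (y + z) (y + z) (y + z) + D x x x + D y y y + D z z z := by
  simp only [map_add, LinearMap.add_apply]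
  have a1 := h1 y x z
  have a2 : D x z y = D x y z := h2 x z y
  have a3 : D y z x = D x y z := by rw [h2, h1]
  have a4 : D z x y = D x y z := by rw [h1, h2]
  have a5 : D z y x = D x y z := by rw [h2, h1, h2]
  rw [a1, a2, a3, a4, a5]
  ring

lemma six_ne (hk2 : (2 : k) ≠ 0) (hk3 : (3 : k) ≠ 0) : (6 : k) ≠ 0 := by
  have : (6 : k) = 2 * 3 := by norm_num
  rw [this]; exact mul_ne_zero hk2 hk3

lemma polar_eq (hk2 : (2 : k) ≠ 0) (hk3 : (3 : k) ≠ 0) (D D' : W →ₗ[k] W →ₗ[k] W →ₗ[k] k)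
    (h1 : ∀ x y z, D x y z = D y x z) (h2 : ∀ x y z, D x y z = D x z y)
    (h1' : ∀ x y z, D' x y z = D' y x z) (h2' : ∀ x y z, D' x y z = D' x z y)
    (h : ∀ x, D x x x = D' x x x) (x y z : W) : D x y z = D' x y z := by
  apply mul_left_cancel₀ (six_ne hk2 hk3)
  rw [polar_id D h1 h2, polar_id D' h1' h2']
  simp only [h]

variable {V : Type*} [AddCommGroup V] [Module k V]

/-- Pullback of a trilinear form. -/
noncomputable def pull (T : V →ₗ[k] V →ₗ[k] V →ₗ[k] k) (φ : W →ₗ[k] V) :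
    W →ₗ[k] W →ₗ[k] W →ₗ[k] k :=
  (T.compl₁₂ φ φ).compr₂ (LinearMap.lcomp k k φ)

@[simp] lemma pull_apply (T : V →ₗ[k] V →ₗ[k] V →ₗ[k] k) (φ : W →ₗ[k] V) (x y z : W) :
    pull T φ x y z = T (φ x) (φ y) (φ z) := rfl

/-- The difference between a trilinear form and a pullback. -/
noncomputable def DD (T : V →ₗ[k] V →ₗ[k] V →ₗ[k] k) (S : W →ₗ[k] W →ₗ[k] W →ₗ[k] k)
    (φ : W →ₗ[k] V) : W →ₗ[k] W →ₗ[k] W →ₗ[k] k :=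
  LinearMap.mk₂ k (fun x y => S x y - pull T φ x y)
    (fun x x' y => by rw [map_add, map_add, LinearMap.add_apply, LinearMap.add_apply]; abel)
    (fun c x y => by
      rw [map_smul, map_smul, LinearMap.smul_apply, LinearMap.smul_apply, smul_sub])
    (fun x y y' => by rw [map_add, map_add]; abel)
    (fun c x y => by rw [map_smul, map_smul, smul_sub])

lemma DD_apply {T : V →ₗ[k] V →ₗ[k] V →ₗ[k] k} (S : W →ₗ[k] W →ₗ[k] W →ₗ[k] k)
    (φ : W →ₗ[k] V) (x y z) :
    DD T S φ x y z = S x y z - T (φ x) (φ y) (φ z) := rfl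

end Poly

section Rem

variable {k V W : Type*} [Field k] [AddCommGroup V] [Module k V] [AddCommGroup W] [Module k W]
variable (T : V →ₗ[k] V →ₗ[k] V →ₗ[k] k) {r : ℕ} (e : Fin r → V) (V₀ : Submodule k V)
  (X : Fin r → W →ₗ[k] k)

/-- finite rank maps congruent to the standard one modulo `V₀`. -/
def Good (φ : W →ₗ[k] V) : Prop :=
  (LinearMap.range φ).FG ∧ ∀ w, φ w - ∑ a, X a w • e a ∈ V₀

/-- Cubic functions which can be realized by modifying `φ` without touching `K`. -/
def Rem (K : Submodule k W) (g : W → k) : Prop :=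
  ∀ φ : W →ₗ[k] V, Good e V₀ X φ → ∃ φ' : W →ₗ[k] V, Good e V₀ X φ' ∧ (∀ w ∈ K, φ' w = φ w) ∧
    ∀ w, T (φ' w) (φ' w) (φ' w) = T (φ w) (φ w) (φ w) + g w

variable {T e V₀ X} {K : Submodule k W}

lemma Rem.zero : Rem T e V₀ X K (fun _ => 0) := fun φ hφ => ⟨φ, hφ, by simp, by simp⟩

lemma Rem.add {g g' : W → k} (h : Rem T e V₀ X K g) (h' : Rem T e V₀ X K g') :
    Rem T e V₀ X K (fun w => g w + g' w) := by
  intro φ hφ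
  obtain ⟨φ₁, h1, h2, h3⟩ := h φ hφ
  obtain ⟨φ₂, k1, k2, k3⟩ := h' φ₁ h1
  exact ⟨φ₂, k1, fun w hw => (k2 w hw).trans (h2 w hw), fun w => by rw [k3, h3]; ring⟩

lemma Rem.sum {ι : Type*} (s : Finset ι) (g : ι → W → k) (h : ∀ i, Rem T e V₀ X K (g i)) :
    Rem T e V₀ X K (fun w => ∑ i ∈ s, g i w) := by
  classical
  induction s using Finset.induction_on with
  | empty => simpa using Rem.zero
  | insert a s ha ih =>
    simp only [Finset.sum_insert ha]
    exact (h a).add ih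

lemma Rem.basic [IsAlgClosed k] (hk2 : (2 : k) ≠ 0) (h : Setup T r e V₀) (c : k) (d : Fin r → k)
    (l : W →ₗ[k] k) (hl : ∀ w ∈ K, l w = 0) :
    Rem T e V₀ X K (fun w => c * l w ^ 3 + 3 * (∑ a, d a * X a w) * l w ^ 2) := by
  intro φ hφ
  let θ : W →ₗ[k] V := φ - ∑ a, (X a).smulRight (e a)
  have hθ : ∀ w, θ w = φ w - ∑ a, X a w • e a := fun w => by simp [θ]
  have hθfg : (LinearMap.range θ).FG := by
    have h1 : LinearMap.range θ ≤
        LinearMap.range φ ⊔ Submodule.span k (Set.range e) := by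
      rintro _ ⟨w, rfl⟩
      rw [hθ]
      refine Submodule.sub_mem _ (Submodule.mem_sup_left ⟨w, rfl⟩) (Submodule.mem_sup_right ?_)
      exact Submodule.sum_mem _ fun a _ => Submodule.smul_mem _ _ (Submodule.subset_span ⟨a, rfl⟩)
    have h2 : (LinearMap.range φ ⊔ Submodule.span k (Set.range e)).FG :=
      hφ.1.sup (Submodule.fg_span (Set.finite_range e))
    exact h2.of_le h1
  obtain ⟨U₁, hU₁, ho₁⟩ := exists_cofg T (LinearMap.range θ) hθfg (by
    rintro _ ⟨w, rfl⟩
    apply h.kerc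
    rw [hθ]; exact hφ.2 w)
  have : Module.Finite k (LinearMap.range φ) := Module.Finite.of_fg hφ.1
  obtain ⟨U₂, hU₂, ho₂⟩ := exists_cofg
    (T.compr₂ (LinearMap.lcomp k k (LinearMap.range φ).subtype)) (LinearMap.range φ) hφ.1
    (fun m _ => Submodule.CoFG.ker _)
  obtain ⟨u, ⟨hu0, hu1, hu2⟩, huc, hud⟩ := h.A hk2 (V₀ ⊓ (U₁ ⊓ U₂)) (h.cof.inf (hU₁.inf hU₂)) c d
  have p1 : ∀ w, T (φ w) u (φ w) = 0 := fun w => by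
    have := ho₂ u hu2 (φ w) ⟨w, rfl⟩
    exact LinearMap.congr_fun this ⟨φ w, ⟨w, rfl⟩⟩
  have p1' : ∀ w, T (φ w) (φ w) u = 0 := fun w => by rw [h.s2, p1]
  have p1'' : ∀ w, T u (φ w) (φ w) = 0 := fun w => by rw [h.s1, p1]
  have p2 : ∀ w, T (φ w) u u = ∑ a, d a * X a w := fun w => by
    have h1 : T (θ w) u u = 0 := by rw [ho₁ u hu1 (θ w) ⟨w, rfl⟩]; rfl
    have h2 : φ w = θ w + ∑ a, X a w • e a := by rw [hθ]; simp
    rw [h2]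
    simp [h1, hud, mul_comm]
  have p2' : ∀ w, T u (φ w) u = ∑ a, d a * X a w := fun w => by rw [h.s1, p2]
  have p2'' : ∀ w, T u u (φ w) = ∑ a, d a * X a w := fun w => by rw [h.s2, p2']
  refine ⟨φ + l.smulRight u, ⟨?_, ?_⟩, ?_, ?_⟩
  · have h1 : LinearMap.range (φ + l.smulRight u) ≤
        LinearMap.range φ ⊔ Submodule.span k {u} := by
      rintro _ ⟨w, rfl⟩
      exact Submodule.add_mem_sup ⟨w, rfl⟩
        (Submodule.smul_mem _ _ (Submodule.mem_span_singleton_self u))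
    exact (hφ.1.sup (Submodule.fg_span_singleton u)).of_le h1
  · intro w
    have := V₀.add_mem (hφ.2 w) (V₀.smul_mem (l w) hu0)
    convert this using 1
    simp; abel
  · intro w hw
    simp [hl w hw]
  · intro w
    simp [p1, p1', p1'', p2, p2', p2'', huc]
    ring

lemma Rem.congr {g g' : W → k} (h : Rem T e V₀ X K g) (hg : ∀ w, g w = g' w) :
    Rem T e V₀ X K g' := by
  have : g = g' := funext hg
  rwa [← this]

lemma Rem.cube [IsAlgClosed k] (hk2 : (2 : k) ≠ 0) (h : Setup T r e V₀) (c : k)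
    (l : W →ₗ[k] k) (hl : ∀ w ∈ K, l w = 0) :
    Rem T e V₀ X K (fun w => c * l w ^ 3) :=
  (Rem.basic hk2 h c 0 l hl).congr (by simp)

lemma Rem.sq [IsAlgClosed k] (hk2 : (2 : k) ≠ 0) (hk3 : (3 : k) ≠ 0) (h : Setup T r e V₀) (c : k)
    (a : Fin r) (l : W →ₗ[k] k) (hl : ∀ w ∈ K, l w = 0) :
    Rem T e V₀ X K (fun w => c * X a w * l w ^ 2) :=
  (Rem.basic hk2 h 0 (Pi.single a (c / 3)) l hl).congr (by
    intro w
    rw [Finset.sum_eq_single a]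
    · rw [Pi.single_eq_same, zero_mul, zero_add]; field_simp
    · intro b _ hb; simp [hb]
    · simp)

lemma Rem.prod3 [IsAlgClosed k] (hk2 : (2 : k) ≠ 0) (hk3 : (3 : k) ≠ 0) (h : Setup T r e V₀) (c : k)
    (l m p : W →ₗ[k] k) (hl : ∀ w ∈ K, l w = 0) (hm : ∀ w ∈ K, m w = 0) (hp : ∀ w ∈ K, p w = 0) :
    Rem T e V₀ X K (fun w => c * l w * m w * p w) := by
  have h24 : (24 : k) ≠ 0 := by
    have : (24 : k) = 2 * 2 * 2 * 3 := by norm_num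
    rw [this]; simp [hk2, hk3]
  refine ((((Rem.cube hk2 h (c / 24) (l + m + p) ?_).add
    (Rem.cube hk2 h (-(c / 24)) (l + m - p) ?_)).add
    (Rem.cube hk2 h (-(c / 24)) (l - m + p) ?_)).add
    (Rem.cube hk2 h (c / 24) (l - m - p) ?_)).congr ?_
  iterate 4
    intro w hw
    simp [hl w hw, hm w hw, hp w hw]
  intro w
  simp only [LinearMap.add_apply, LinearMap.sub_apply]
  field_simp
  ring

lemma Rem.prod2 [IsAlgClosed k] (hk2 : (2 : k) ≠ 0) (hk3 : (3 : k) ≠ 0) (h : Setup T r e V₀) (c : k)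
    (a : Fin r) (l m : W →ₗ[k] k) (hl : ∀ w ∈ K, l w = 0) (hm : ∀ w ∈ K, m w = 0) :
    Rem T e V₀ X K (fun w => c * X a w * l w * m w) := by
  have h4 : (4 : k) ≠ 0 := by
    have : (4 : k) = 2 * 2 := by norm_num
    rw [this]; simp [hk2]
  refine ((Rem.sq hk2 hk3 h (c / 4) a (l + m) ?_).add
    (Rem.sq hk2 hk3 h (-(c / 4)) a (l - m) ?_)).congr ?_
  iterate 2
    intro w hw
    simp [hl w hw, hm w hw]
  intro w
  simp only [LinearMap.add_apply, LinearMap.sub_apply]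
  field_simp
  ring

end Rem

section WSide

variable {k : Type*} [Field k] {r : ℕ}

/-- truncation killing the first `n` coordinates. -/
noncomputable def tr (k : Type*) [Field k] (n : ℕ) : (ℕ →₀ k) →ₗ[k] (ℕ →₀ k) where
  toFun := Finsupp.filter (fun i => n ≤ i)
  map_add' _ _ := Finsupp.filter_add
  map_smul' _ _ := Finsupp.filter_smul

lemma tr_apply (n : ℕ) (y : ℕ →₀ k) (i : ℕ) : tr k n y i = if n ≤ i then y i else 0 := by
  show Finsupp.filter (fun i => n ≤ i) y i = _
  rw [Finsupp.filter_apply]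

lemma tr_succ (n : ℕ) (y : ℕ →₀ k) : tr k n y = y n • Finsupp.single n 1 + tr k (n + 1) y := by
  ext i
  simp only [tr_apply, Finsupp.add_apply, Finsupp.smul_apply, Finsupp.single_apply, smul_eq_mul]
  rcases lt_trichotomy i n with hi | hi | hi
  · simp [show ¬ n ≤ i by omega, show ¬ n + 1 ≤ i by omega, show n ≠ i by omega]
  · subst hi; simp
  · simp [show n ≤ i by omega, show n + 1 ≤ i by omega, show n ≠ i by omega]

lemma tr_tr (n : ℕ) (y : ℕ →₀ k) : tr k n (tr k n y) = tr k n y := by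
  ext i; simp only [tr_apply]; split_ifs <;> rfl

lemma tr_zero (y : ℕ →₀ k) : tr k 0 y = y := by
  ext i; simp [tr_apply]

lemma tr_single (n m : ℕ) (h : m < n) : tr k n (Finsupp.single m 1) = 0 := by
  ext i
  simp only [tr_apply, Finsupp.single_apply]
  split_ifs <;> first | rfl | omega

abbrev WW (k : Type*) [Field k] (r : ℕ) : Type _ := (Fin r → k) × (ℕ →₀ k)

/-- the coordinates on the first factor -/
noncomputable def XX (k : Type*) [Field k] (r : ℕ) (a : Fin r) : WW k r →ₗ[k] k :=
  LinearMap.proj a ∘ₗ LinearMap.fst k _ _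

/-- basis vectors of the first factor -/
noncomputable def EE (k : Type*) [Field k] {r : ℕ} (a : Fin r) : WW k r := (Pi.single a 1, 0)

/-- basis vectors of the second factor -/
noncomputable def BB (k : Type*) [Field k] (r : ℕ) (n : ℕ) : WW k r := (0, Finsupp.single n 1)

/-- coordinates on the second factor -/
noncomputable def CC (k : Type*) [Field k] (r : ℕ) (n : ℕ) : WW k r →ₗ[k] k :=
  Finsupp.lapply n ∘ₗ LinearMap.snd k _ _

/-- projection to the tail -/
noncomputable def RR (k : Type*) [Field k] (r : ℕ) (n : ℕ) : WW k r →ₗ[k] WW k r :=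
  LinearMap.inr k _ _ ∘ₗ tr k n ∘ₗ LinearMap.snd k _ _

/-- projection to the first factor -/
noncomputable def FF (k : Type*) [Field k] (r : ℕ) : WW k r →ₗ[k] WW k r :=
  LinearMap.inl k _ _ ∘ₗ LinearMap.fst k _ _

/-- projection killing first `n` basis vectors of the second factor -/
noncomputable def PP (k : Type*) [Field k] (r : ℕ) (n : ℕ) : WW k r →ₗ[k] WW k r :=
  FF k r + RR k r n

lemma FF_eq (v : WW k r) : FF k r v = ∑ a, XX k r a v • EE k a := by
  ext i
  · simp [FF, XX, EE, Prod.fst_sum, Finset.sum_apply, Pi.single_apply]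
  · simp [FF, XX, EE, Prod.snd_sum]

lemma PP_apply (n : ℕ) (v : WW k r) : PP k r n v = FF k r v + RR k r n v := rfl

lemma RR_succ (n : ℕ) (v : WW k r) :
    RR k r n v = CC k r n v • BB k r n + RR k r (n + 1) v := by
  simp [RR, CC, BB, tr_succ n v.2]

lemma FF_FF (v : WW k r) : FF k r (FF k r v) = FF k r v := rfl
lemma RR_FF (n : ℕ) (v : WW k r) : RR k r n (FF k r v) = 0 := by simp [RR, FF]
lemma FF_RR (n : ℕ) (v : WW k r) : FF k r (RR k r n v) = 0 := by simp [RR, FF]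
lemma RR_RR (n : ℕ) (v : WW k r) : RR k r n (RR k r n v) = RR k r n v := by simp [RR, tr_tr]
lemma PP_FF (n : ℕ) (v : WW k r) : PP k r n (FF k r v) = FF k r v := by
  simp [PP_apply, FF_FF, RR_FF]
lemma PP_PP (n : ℕ) (v : WW k r) : PP k r n (PP k r n v) = PP k r n v := by
  simp only [PP_apply, map_add, FF_FF, RR_FF, FF_RR, RR_RR, add_zero, zero_add]
lemma PP_zero (v : WW k r) : PP k r 0 v = v := by
  simp [PP, FF, RR, tr_zero]

variable {V : Type*} [AddCommGroup V] [Module k V]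
variable {T : V →ₗ[k] V →ₗ[k] V →ₗ[k] k} {e : Fin r → V} {V₀ : Submodule k V}

/-- The invariant of the inductive construction. -/
structure Inv (T : V →ₗ[k] V →ₗ[k] V →ₗ[k] k) (e : Fin r → V) (V₀ : Submodule k V)
    (S : WW k r →ₗ[k] WW k r →ₗ[k] WW k r →ₗ[k] k) (n : ℕ) (φ : WW k r →ₗ[k] V) : Prop where
  good : Good e V₀ (XX k r) φ
  kill : ∀ x y z, DD T S φ x y z = DD T S φ (PP k r n x) (PP k r n y) (PP k r n z)
  van : ∀ x y z, DD T S φ (FF k r x) (FF k r y) z = 0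

variable {S : WW k r →ₗ[k] WW k r →ₗ[k] WW k r →ₗ[k] k}

/-- Quadratic forms `S(b_n, v, v)` are finite sums of products. -/
def FinS (S : WW k r →ₗ[k] WW k r →ₗ[k] WW k r →ₗ[k] k) : Prop :=
  ∀ n, ∃ (N : ℕ) (l m : Fin N → WW k r →ₗ[k] k), ∀ v, S (BB k r n) v v = ∑ i, l i v * m i v

/-- Same for `T`. -/
def FinT (T : V →ₗ[k] V →ₗ[k] V →ₗ[k] k) (V₀ : Submodule k V) : Prop :=
  ∀ u ∈ V₀, ∃ (N : ℕ) (l m : Fin N → V →ₗ[k] k), ∀ v, T u v v = ∑ i, l i v * m i v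

lemma DD_fin (hS : FinS S) (hT : FinT T V₀) (φ : WW k r →ₗ[k] V) (hφ : Good e V₀ (XX k r) φ)
    (n : ℕ) : ∃ (N : ℕ) (l m : Fin N → WW k r →ₗ[k] k),
      ∀ v, DD T S φ (BB k r n) v v = ∑ i, l i v * m i v := by
  have hb : φ (BB k r n) ∈ V₀ := by
    have := hφ.2 (BB k r n)
    simpa [XX, BB] using this
  obtain ⟨N, l, m, h⟩ := hS n
  obtain ⟨N', l', m', h'⟩ := hT _ hb
  refine ⟨N + N', Fin.append l (fun i => - (l' i ∘ₗ φ)), Fin.append m (fun i => m' i ∘ₗ φ), ?_⟩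
  intro v
  simp [DD_apply, Fin.sum_univ_add, Fin.append_left, Fin.append_right, h, h', sub_eq_add_neg]

lemma DD_s1 (h1 : ∀ x y z, S x y z = S y x z) (h : Setup T r e V₀) (φ : WW k r →ₗ[k] V) :
    ∀ x y z, DD T S φ x y z = DD T S φ y x z := fun x y z => by
  rw [DD_apply, DD_apply, h1, h.s1]

lemma DD_s2 (h1 : ∀ x y z, S x y z = S x z y) (h : Setup T r e V₀) (φ : WW k r →ₗ[k] V) :
    ∀ x y z, DD T S φ x y z = DD T S φ x z y := fun x y z => by
  rw [DD_apply, DD_apply, h1, h.s2]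

lemma init_step [IsAlgClosed k] (hk2 : (2 : k) ≠ 0) (hk3 : (3 : k) ≠ 0) (h : Setup T r e V₀)
    (hS1 : ∀ x y z, S x y z = S y x z) (hS2 : ∀ x y z, S x y z = S x z y) :
    ∃ φ, Inv T e V₀ S 0 φ := by
  let φ₀ : WW k r →ₗ[k] V := ∑ a, (XX k r a).smulRight (e a)
  have hφ₀ : ∀ w, φ₀ w = ∑ a, XX k r a w • e a := fun w => by simp [φ₀]
  have hgood : Good e V₀ (XX k r) φ₀ := by
    constructor
    · have : LinearMap.range φ₀ ≤ Submodule.span k (Set.range e) := by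
        rintro _ ⟨w, rfl⟩
        rw [hφ₀]
        exact Submodule.sum_mem _ fun a _ =>
          Submodule.smul_mem _ _ (Submodule.subset_span ⟨a, rfl⟩)
      exact (Submodule.fg_span (Set.finite_range e)).of_le this
    · intro w; rw [hφ₀]; simp
  set D := DD T S φ₀ with hD
  have s1 := DD_s1 hS1 h φ₀
  have s2 := DD_s2 hS2 h φ₀
  have hrem : Rem T e V₀ (XX k r) (⊥ : Submodule k (WW k r))
      (fun v => D (FF k r v) (FF k r v) (FF k r v) + 3 * D (FF k r v) (FF k r v) (RR k r 0 v)) := by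
    have hb : ∀ l : WW k r →ₗ[k] k, ∀ w ∈ (⊥ : Submodule k (WW k r)), l w = 0 := by
      intro l w hw; rw [Submodule.mem_bot] at hw; simp [hw]
    refine ((Rem.sum Finset.univ _ fun a => Rem.sum Finset.univ _ fun b =>
      Rem.sum Finset.univ _ fun c =>
      Rem.prod3 hk2 hk3 h (D (EE k a) (EE k b) (EE k c)) (XX k r a) (XX k r b) (XX k r c)
        (hb _) (hb _) (hb _)).add
      (Rem.sum Finset.univ _ fun a => Rem.sum Finset.univ _ fun b =>
      Rem.prod3 hk2 hk3 h 3 (XX k r a) (XX k r b) (D (EE k a) (EE k b) ∘ₗ RR k r 0)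
        (hb _) (hb _) (hb _))).congr ?_
    intro v
    have L1 : ∀ y z, D (FF k r v) y z = ∑ a, XX k r a v * D (EE k a) y z := by
      intro y z
      rw [FF_eq, map_sum, LinearMap.sum_apply, LinearMap.sum_apply]
      simp
    have L2 : ∀ y z, D y (FF k r v) z = ∑ a, XX k r a v * D y (EE k a) z := by
      intro y z
      rw [FF_eq, map_sum, LinearMap.sum_apply]
      simp
    have L3 : ∀ y z, D y z (FF k r v) = ∑ a, XX k r a v * D y z (EE k a) := by
      intro y z
      rw [FF_eq, map_sum]
      simp
    rw [L1, L1]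
    simp only [L2, L3, Finset.mul_sum, LinearMap.comp_apply]
    congr 1
    · exact Finset.sum_congr rfl fun a _ => Finset.sum_congr rfl fun b _ =>
        Finset.sum_congr rfl fun c _ => by ring
    · exact Finset.sum_congr rfl fun a _ => Finset.sum_congr rfl fun b _ => by ring
  obtain ⟨φ, hφ, -, hφ'⟩ := hrem φ₀ hgood
  refine ⟨φ, hφ, fun x y z => by simp only [PP_zero], ?_⟩
  have key : ∀ v, DD T S φ v v v = 3 * D (FF k r v) (RR k r 0 v) (RR k r 0 v) +
      D (RR k r 0 v) (RR k r 0 v) (RR k r 0 v) := by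
    intro v
    have e1 : DD T S φ v v v = D v v v - (D (FF k r v) (FF k r v) (FF k r v) +
        3 * D (FF k r v) (FF k r v) (RR k r 0 v)) := by
      rw [hD, DD_apply, hφ', DD_apply S φ₀ v v v]; ring
    rw [e1]
    have e2 : v = FF k r v + RR k r 0 v := by rw [← PP_apply, PP_zero]
    generalize FF k r v = x at *
    generalize RR k r 0 v = y at *
    subst e2
    simp only [map_add, LinearMap.add_apply]
    have a1 : D x y x = D x x y := by rw [s2]
    have a2 : D y x x = D x x y := by rw [s1, s2]
    have a3 : D y x y = D x y y := by rw [s1]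
    have a4 : D y y x = D x y y := by rw [s2, s1]
    rw [a1, a2, a3, a4]; ring
  intro x y z
  have h6 := polar_id (DD T S φ) (DD_s1 hS1 h φ) (DD_s2 hS2 h φ) (FF k r x) (FF k r y) z
  apply mul_left_cancel₀ (six_ne hk2 hk3)
  rw [h6]
  simp only [key]
  simp only [map_add, RR_FF, FF_FF, LinearMap.add_apply, zero_add, map_zero,
    add_zero, mul_zero]
  ring

lemma succ_step [IsAlgClosed k] (hk2 : (2 : k) ≠ 0) (hk3 : (3 : k) ≠ 0) (h : Setup T r e V₀)
    (hS1 : ∀ x y z, S x y z = S y x z) (hS2 : ∀ x y z, S x y z = S x z y)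
    (hS : FinS S) (hT : FinT T V₀) (n : ℕ) (φ : WW k r →ₗ[k] V) (hI : Inv T e V₀ S n φ) :
    ∃ φ', Inv T e V₀ S (n + 1) φ' ∧ ∀ v, RR k r n v = 0 → φ' v = φ v := by
  obtain ⟨N, l, m, hlm⟩ := DD_fin hS hT φ hI.good n
  have s1 := DD_s1 hS1 h φ
  have s2 := DD_s2 hS2 h φ
  have hkill := hI.kill
  have hvan := hI.van
  set D := DD T S φ with hD
  let K : Submodule k (WW k r) := LinearMap.ker (RR k r n)
  set b := BB k r n with hb
  have hKR : ∀ w ∈ K, RR k r (n + 1) w = 0 ∧ CC k r n w = 0 := by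
    intro w hw
    have hw' : tr k n w.2 = 0 := by
      have : RR k r n w = 0 := hw
      have := congrArg Prod.snd this
      simpa [RR] using this
    have hc : CC k r n w = 0 := by
      have := DFunLike.congr_fun hw' n
      simpa [tr_apply, CC] using this
    refine ⟨?_, hc⟩
    have := RR_succ n w
    rw [show RR k r n w = 0 from hw, hc] at this
    simpa using this.symm
  have hR : ∀ p : WW k r →ₗ[k] k, ∀ w ∈ K, (p ∘ₗ RR k r (n + 1)) w = 0 := by
    intro p w hw; simp [(hKR w hw).1]
  have hC : ∀ w ∈ K, CC k r n w = 0 := fun w hw => (hKR w hw).2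
  have hrem : Rem T e V₀ (XX k r) K
      (fun v => CC k r n v ^ 3 * D b b b + 3 * CC k r n v ^ 2 * D b b (RR k r (n + 1) v)
        + 3 * CC k r n v ^ 2 * D b b (FF k r v)
        + 3 * CC k r n v * D b (RR k r (n + 1) v) (RR k r (n + 1) v)
        + 6 * CC k r n v * D b (FF k r v) (RR k r (n + 1) v)) := by
    refine (((((Rem.cube hk2 h (D b b b) _ hC).add
      (Rem.prod3 hk2 hk3 h 3 _ _ (D b b ∘ₗ RR k r (n + 1)) hC hC (hR _))).add
      (Rem.sum Finset.univ _ fun a => Rem.prod2 hk2 hk3 h (3 * D b b (EE k a)) a _ _ hC hC)).add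
      (Rem.sum Finset.univ _ fun i => Rem.prod3 hk2 hk3 h 3 _ (l i ∘ₗ RR k r (n + 1))
        (m i ∘ₗ RR k r (n + 1)) hC (hR _) (hR _))).add
      (Rem.sum Finset.univ _ fun a => Rem.prod2 hk2 hk3 h 6 a _
        (D b (EE k a) ∘ₗ RR k r (n + 1)) hC (hR _))).congr ?_
    intro v
    simp only [FF_eq, map_sum, LinearMap.sum_apply, map_smul, LinearMap.smul_apply, smul_eq_mul,
      Finset.mul_sum, LinearMap.comp_apply, hlm (RR k r (n + 1) v)]
    congr 1
    · congr 1
      · congr 1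
        · ring
        · exact Finset.sum_congr rfl fun a _ => by ring
      · exact Finset.sum_congr rfl fun a _ => by ring
    · exact Finset.sum_congr rfl fun a _ => by ring
  obtain ⟨φ', hφ, hφK, hφ'⟩ := hrem φ hI.good
  have key : ∀ v, DD T S φ' v v v =
      D (PP k r (n + 1) v) (PP k r (n + 1) v) (PP k r (n + 1) v) := by
    intro v
    have e1 : ∀ g, T (φ' v) (φ' v) (φ' v) = T (φ v) (φ v) (φ v) + g →
        DD T S φ' v v v = D v v v - g := by
      intro g hg
      rw [DD_apply, hg, hD, DD_apply S φ v v v, ← sub_sub]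
    rw [e1 _ (hφ' v)]
    beta_reduce
    rw [hkill v v v, PP_apply, PP_apply, RR_succ n v, ← hb]
    have v1 : ∀ z, D (FF k r v) (FF k r v) z = 0 := fun z => hvan v v z
    generalize FF k r v = x at *
    generalize RR k r (n + 1) v = y at *
    generalize CC k r n v = t at *
    have a1 : D x b x = 0 := by rw [s2, v1]
    have a2 : D b x x = 0 := by rw [s1, a1]
    have a3 : D b y x = D b x y := by rw [s2]
    have a4 : D x b y = D b x y := by rw [s1]
    have a5 : D y b x = D b x y := by rw [s1, a3]
    have a6 : D x y b = D b x y := by rw [s2, a4]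
    have a7 : D y x b = D b x y := by rw [s2, a5]
    have a8 : D b x b = D b b x := by rw [s2]
    have a9 : D x b b = D b b x := by rw [s1, a8]
    have a10 : D b y b = D b b y := by rw [s2]
    have a11 : D y b b = D b b y := by rw [s1, a10]
    have a12 : D y b y = D b y y := by rw [s1]
    have a13 : D y y b = D b y y := by rw [s2, a12]
    simp only [map_add, LinearMap.add_apply, map_smul, LinearMap.smul_apply, smul_eq_mul,
      v1, a1, a2, a3, a4, a5, a6, a7, a8, a9, a10, a11, a12, a13]
    ring
  have key2 : ∀ x y z, DD T S φ' x y z =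
      D (PP k r (n + 1) x) (PP k r (n + 1) y) (PP k r (n + 1) z) := by
    intro x y z
    exact polar_eq hk2 hk3 (DD T S φ') (pull D (PP k r (n + 1))) (DD_s1 hS1 h φ') (DD_s2 hS2 h φ')
      (fun x y z => by simp only [pull_apply]; exact s1 _ _ _)
      (fun x y z => by simp only [pull_apply]; exact s2 _ _ _) (fun v => key v) x y z
  refine ⟨φ', ⟨hφ, ?_, ?_⟩, fun v hv => hφK v hv⟩
  · intro x y z
    rw [key2, key2 (PP k r (n + 1) x)]
    simp only [PP_PP]
  · intro x y z
    rw [key2, PP_FF, PP_FF, hvan]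

lemma RR_eq_zero (n : ℕ) (v : WW k r) (h : ∀ i ∈ v.2.support, i < n) : RR k r n v = 0 := by
  have : tr k n v.2 = 0 := by
    ext i
    rw [tr_apply]
    split_ifs with hi
    · by_contra hne
      have := h i (Finsupp.mem_support_iff.2 hne)
      omega
    · rfl
  simp [RR, this]

theorem main_WW [IsAlgClosed k] (hk2 : (2 : k) ≠ 0) (hk3 : (3 : k) ≠ 0) (h : Setup T r e V₀)
    (hS1 : ∀ x y z, S x y z = S y x z) (hS2 : ∀ x y z, S x y z = S x z y)
    (hS : FinS S) (hT : FinT T V₀) :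
    ∃ φ : WW k r →ₗ[k] V, ∀ x y z, T (φ x) (φ y) (φ z) = S x y z := by
  obtain ⟨φ₀, hφ₀⟩ := init_step hk2 hk3 h hS1 hS2
  choose step hstep1 hstep2 using succ_step hk2 hk3 h hS1 hS2 hS hT
  let seq : (n : ℕ) → {φ : WW k r →ₗ[k] V // Inv T e V₀ S n φ} := fun n =>
    Nat.rec ⟨φ₀, hφ₀⟩ (fun n p => ⟨step n p.1 p.2, hstep1 n p.1 p.2⟩) n
  have hsucc : ∀ n v, RR k r n v = 0 → (seq (n + 1)).1 v = (seq n).1 v := fun n v hv =>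
    hstep2 n (seq n).1 (seq n).2 v hv
  let Φ : WW k r →ₗ[k] V := LinearMap.coprod ((seq 0).1 ∘ₗ LinearMap.inl k _ _)
    (Finsupp.linearCombination k fun n => (seq (n + 1)).1 (BB k r n))
  have hA : ∀ N x, (seq N).1 (x, 0) = (seq 0).1 (x, 0) := by
    intro N x
    induction N with
    | zero => rfl
    | succ N ih => rw [hsucc N _ (RR_eq_zero _ _ (by simp)), ih]
  have hB : ∀ N n, n < N → (seq N).1 (BB k r n) = (seq (n + 1)).1 (BB k r n) := by
    intro N n hn
    induction N, hn using Nat.le_induction with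
    | base => rfl
    | succ N hN ih =>
      rw [hsucc N _ (RR_eq_zero _ _ ?_), ih]
      intro i hi
      have : i = n := by
        simpa [BB] using hi
      omega
  have hΦ : ∀ N (v : WW k r), (∀ i ∈ v.2.support, i < N) → Φ v = (seq N).1 v := by
    rintro N ⟨x, y⟩ hv
    have e1 : ((x, y) : WW k r) = (x, 0) + y.sum fun n c => c • BB k r n := by
      have : (y.sum fun n c => c • BB k r n) = ((0, y) : WW k r) := by
        have h2 : (y.sum fun n c => c • BB k r n) =
            LinearMap.inr k (Fin r → k) (ℕ →₀ k) (y.sum fun n c => Finsupp.single n c) := by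
          rw [Finsupp.sum, Finsupp.sum, map_sum]
          refine Finset.sum_congr rfl fun n _ => ?_
          simp [BB]
        rw [h2, Finsupp.sum_single]; rfl
      rw [this]; simp
    have e2 : Φ (x, y) = (seq 0).1 (x, 0) + y.sum fun n c => c • (seq (n + 1)).1 (BB k r n) := by
      simp [Φ, Finsupp.linearCombination_apply]
    rw [e2]
    conv_rhs => rw [e1]
    rw [map_add, hA N, Finsupp.sum, Finsupp.sum, map_sum]
    congr 1
    refine Finset.sum_congr rfl fun n hn => ?_
    rw [map_smul, hB N n (hv n hn)]
  refine ⟨Φ, fun x y z => ?_⟩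
  refine polar_eq hk2 hk3 (pull T Φ) S (fun _ _ _ => h.s1 _ _ _) (fun _ _ _ => h.s2 _ _ _)
    hS1 hS2 ?_ x y z
  intro v
  obtain ⟨N, hN⟩ : ∃ N, ∀ i ∈ v.2.support, i < N :=
    ⟨v.2.support.sup id + 1, fun i hi => Nat.lt_succ_of_le (Finset.le_sup (f := id) hi)⟩
  rw [pull_apply, hΦ N v hN]
  have h0 : DD T S (seq N).1 v v v = 0 := by
    rw [(seq N).2.kill, PP_apply, RR_eq_zero N v hN, add_zero, (seq N).2.van]
  rw [DD_apply] at h0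
  exact (sub_eq_zero.1 h0).symm

end WSide

section Final

variable {k V : Type*} [Field k] [AddCommGroup V] [Module k V]

/-- The linear map `v ↦ class of f_v`. -/
noncomputable def clMap (T : V →ₗ[k] V →ₗ[k] V →ₗ[k] k) :
    V →ₗ[k] (QuadraticForm k V ⧸ FinStrength k V) where
  toFun v := Submodule.Quotient.mk (p := FinStrength k V) (fQuad T v)
  map_add' x y := by
    rw [← Submodule.Quotient.mk_add]
    congr 1
    ext v
    simp [fQuad]
  map_smul' c x := by
    rw [RingHom.id_apply, ← Submodule.Quotient.mk_smul]
    congr 1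
    ext v
    simp [fQuad]
    ring

lemma rrk_eq (T : V →ₗ[k] V →ₗ[k] V →ₗ[k] k) :
    rrk k T = Module.rank k (LinearMap.range (clMap T)) := by
  have : Submodule.span k
    (Set.range fun v => Submodule.Quotient.mk (p := FinStrength k V) (fQuad T v)) =
      LinearMap.range (clMap T) := by
    have h : (Set.range fun v => Submodule.Quotient.mk (p := FinStrength k V) (fQuad T v)) =
      (LinearMap.range (clMap T) : Set _) := by
      rw [LinearMap.coe_range]; rfl
    rw [h, Submodule.span_eq]
  rw [rrk, this]

lemma finT_ker (hk3 : (3 : k) ≠ 0) (T : V →ₗ[k] V →ₗ[k] V →ₗ[k] k) :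
    FinT T (LinearMap.ker (clMap T)) := by
  intro u hu
  have h1 : fQuad T u ∈ FinStrength k V := by
    rw [LinearMap.mem_ker] at hu
    exact (Submodule.Quotient.mk_eq_zero _).1 hu
  obtain ⟨n, l, m, h⟩ := h1
  refine ⟨n, fun i => (3 : k)⁻¹ • l i, m, fun v => ?_⟩
  have := h v
  have h2 : (3 : k) * T u v v = ∑ i, l i v * m i v := by
    rw [← this]; simp [fQuad]
  simp only [LinearMap.smul_apply, smul_eq_mul, mul_assoc]
  rw [← Finset.mul_sum, ← h2]
  field_simp

lemma exists_setup (hk2 : (2 : k) ≠ 0) (hk3 : (3 : k) ≠ 0) (r : ℕ)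
    (T : V →ₗ[k] V →ₗ[k] V →ₗ[k] k)
    (hT1 : ∀ x y z, T x y z = T y x z) (hT2 : ∀ x y z, T x y z = T x z y)
    (hV : ¬ FiniteStrengthCubic k T) (hVrrk : rrk k T = (r : Cardinal)) :
    ∃ e : Fin r → V, Setup T r e (LinearMap.ker (clMap T)) := by
  rw [rrk_eq] at hVrrk
  have hfin : Module.Finite k (LinearMap.range (clMap T)) := by
    rw [← Module.rank_lt_aleph0_iff, hVrrk]
    exact Cardinal.natCast_lt_aleph0
  have hfr : Module.finrank k (LinearMap.range (clMap T)) = r := by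
    rw [Module.finrank, hVrrk]; simp
  let b := Module.finBasisOfFinrankEq k _ hfr
  choose e he using fun a => (b a).2
  refine ⟨e, hT1, hT2, ?_, ?_, ?_, exists_cubic_ne T hV⟩
  · rw [← Submodule.range_fg_iff_ker_cofg]
    exact Module.Finite.iff_fg.1 hfin
  · intro v hv
    obtain ⟨n, l, m, h⟩ := finT_ker hk3 T v hv
    exact ker_cofg_of_finStrength hk2 (T v) (hT2 v) n l m h
  · intro c hc U hU
    have := exists_quad_ne (T (∑ a, c a • e a)) ?_ U hU
    · obtain ⟨u, hu, h⟩ := this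
      refine ⟨u, hu, ?_⟩
      simpa using h
    · intro hmem
      apply hc
      have h1 : fQuad T (∑ a, c a • e a) ∈ FinStrength k V := by
        have h3 := (FinStrength k V).smul_mem (3 : k) hmem
        convert h3 using 1
        ext v
        simp [fQuad]
      have h2 : clMap T (∑ a, c a • e a) = 0 := (Submodule.Quotient.mk_eq_zero _).2 h1
      have h4 : ∑ a, c a • b a = 0 := by
        apply Subtype.ext
        simpa [he] using h2
      funext a
      exact Fintype.linearIndependent_iff.1 b.linearIndependent c h4 a

lemma exists_cover {W : Type*} [AddCommGroup W] [Module k W] (hk3 : (3 : k) ≠ 0) (r : ℕ)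
    (S : W →ₗ[k] W →ₗ[k] W →ₗ[k] k)
    (hW : Module.rank k W ≤ Cardinal.aleph0) (hWrrk : rrk k S ≤ (r : Cardinal)) :
    ∃ π : WW k r →ₗ[k] W, Function.Surjective π ∧ FinS (pull S π) := by
  classical
  rw [rrk_eq] at hWrrk
  have hfin : Module.Finite k (LinearMap.range (clMap S)) := by
    rw [← Module.rank_lt_aleph0_iff]
    exact hWrrk.trans_lt Cardinal.natCast_lt_aleph0
  have hfr : Module.finrank k (LinearMap.range (clMap S)) ≤ r := by
    rw [← Module.finrank_eq_rank] at hWrrk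
    exact_mod_cast hWrrk
  let b := Module.finBasis k (LinearMap.range (clMap S))
  choose w hw using fun a => (b a).2
  let w' : Fin r → W := fun a => if h : a.1 < Module.finrank k (LinearMap.range (clMap S)) then
    w ⟨a.1, h⟩ else 0
  let W₀ := LinearMap.ker (clMap S)
  let b₀ := Module.Basis.ofVectorSpace k W₀
  have hcount : Countable (Module.Basis.ofVectorSpaceIndex k W₀) := by
    rw [← Cardinal.mk_le_aleph0_iff, b₀.mk_eq_rank'']
    exact (Submodule.rank_le W₀).trans hW
  let _ : Encodable (Module.Basis.ofVectorSpaceIndex k W₀) := Encodable.ofCountable _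
  let c : ℕ → W₀ := fun n => match Encodable.decode (α := Module.Basis.ofVectorSpaceIndex k W₀) n with
    | some i => b₀ i
    | none => 0
  have hc : ∀ i, c (Encodable.encode i) = b₀ i := fun i => by simp [c]
  let π : WW k r →ₗ[k] W := LinearMap.coprod (Fintype.linearCombination k w')
    (Finsupp.linearCombination k fun n => (c n : W))
  have hπB : ∀ n, π (BB k r n) = c n := fun n => by simp [π, BB]
  have hπE : ∀ a, π (EE k a) = w' a := fun a => by
    simp [π, EE]
  refine ⟨π, ?_, ?_⟩
  · have h0 : W₀ ≤ LinearMap.range π := by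
      have h1 : Submodule.span k (Set.range b₀) ≤ (LinearMap.range π).comap W₀.subtype := by
        rw [Submodule.span_le]
        rintro _ ⟨i, rfl⟩
        exact ⟨BB k r (Encodable.encode i), by rw [hπB, hc]; rfl⟩
      rw [b₀.span_eq] at h1
      intro x hx
      exact h1 (x := ⟨x, hx⟩) trivial
    have hw2 : ∀ a, w a ∈ LinearMap.range π := fun a =>
      ⟨EE k ⟨a.1, a.2.trans_le hfr⟩, by rw [hπE]; simp [w']⟩
    intro x
    let y : W := ∑ a, b.repr ⟨clMap S x, ⟨x, rfl⟩⟩ a • w a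
    have hy : y ∈ LinearMap.range π :=
      Submodule.sum_mem _ fun a _ => Submodule.smul_mem _ _ (hw2 a)
    have hxy : x - y ∈ W₀ := by
      rw [LinearMap.mem_ker, map_sub, sub_eq_zero]
      have := congrArg Subtype.val (b.sum_repr ⟨clMap S x, ⟨x, rfl⟩⟩)
      refine this.symm.trans ?_
      simp [y, hw, -Module.Basis.sum_repr]
    have := Submodule.add_mem _ (h0 hxy) hy
    rw [sub_add_cancel] at this
    exact this
  · intro n
    obtain ⟨N, l, m, h⟩ := finT_ker hk3 S (c n) (c n).2
    refine ⟨N, fun i => l i ∘ₗ π, fun i => m i ∘ₗ π, fun v => ?_⟩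
    rw [pull_apply, hπB, h]
    rfl

end Final

end CubicEmb

/-- Proposition 5.1 of the paper. Let `(V,T)` be a non-degenerate
cubic space of finite residual rank `r`. Then every cubic space of countable dimension
and residual rank at most `r` embeds into it. -/
theorem cubic_embedding_of_finite_rrk
    {k V W : Type*} [Field k] [IsAlgClosed k]
    (hk2 : (2 : k) ≠ 0) (hk3 : (3 : k) ≠ 0)
    [AddCommGroup V] [Module k V] [AddCommGroup W] [Module k W]
    (r : ℕ)
    (T : V →ₗ[k] V →ₗ[k] V →ₗ[k] k)
    (hT1 : ∀ x y z, T x y z = T y x z) (hT2 : ∀ x y z, T x y z = T x z y)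
    (hV : ¬ FiniteStrengthCubic k T) (hVrrk : rrk k T = (r : Cardinal))
    (S : W →ₗ[k] W →ₗ[k] W →ₗ[k] k)
    (hS1 : ∀ x y z, S x y z = S y x z) (hS2 : ∀ x y z, S x y z = S x z y)
    (hW : Module.rank k W ≤ Cardinal.aleph0) (hWrrk : rrk k S ≤ (r : Cardinal)) :
    ∃ φ : W →ₗ[k] V, ∀ x y z, T (φ x) (φ y) (φ z) = S x y z := by
  obtain ⟨e, hsetup⟩ := CubicEmb.exists_setup hk2 hk3 r T hT1 hT2 hV hVrrk
  obtain ⟨π, hπ, hfin⟩ := CubicEmb.exists_cover hk3 r S hW hWrrk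
  obtain ⟨φ, hφ⟩ := CubicEmb.main_WW (S := CubicEmb.pull S π) hk2 hk3 hsetup
    (fun _ _ _ => hS1 _ _ _) (fun _ _ _ => hS2 _ _ _) hfin (CubicEmb.finT_ker hk3 T)
  obtain ⟨s, hs⟩ := LinearMap.exists_rightInverse_of_surjective π (LinearMap.range_eq_top.2 hπ)
  have hs' : ∀ x, π (s x) = x := fun x => LinearMap.congr_fun hs x
  refine ⟨φ ∘ₗ s, fun x y z => ?_⟩
  have := hφ (s x) (s y) (s z)
  rw [CubicEmb.pull_apply, hs', hs', hs'] at this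
  exact this
end

section
/- Let (V,T) be a cubic space over k. Then there exist finitely many linear forms b_1,…,b_n on V with T(x,x,x) = Σ_{i=1}^n b_i(x)³ for all x ∈ V if and only if (V,T) has finite strength and rrk(V,T) = 0. -/
open scoped BigOperators

/-- The span of cubes of linear forms, as functions. -/
def cubeSpan (k V : Type*) [Field k] [AddCommGroup V] [Module k V] : Submodule k (V → k) :=
  Submodule.span k (Set.range fun (b : V →ₗ[k] k) => fun x => b x ^ 3)

theorem cubeSpan_exists {k V : Type*} [Field k] [IsAlgClosed k] [AddCommGroup V] [Module k V]
    {f : V → k} (hf : f ∈ cubeSpan k V) :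
    ∃ (n : ℕ) (b : Fin n → V →ₗ[k] k), ∀ x, f x = ∑ i, b i x ^ 3 := by
  unfold cubeSpan at hf
  induction hf using Submodule.span_induction with
  | mem f h =>
    obtain ⟨b, rfl⟩ := h
    exact ⟨1, fun _ => b, fun x => by simp⟩
  | zero => exact ⟨0, ![], fun x => by simp⟩
  | add f g _ _ hf hg =>
    obtain ⟨n, b, h⟩ := hf
    obtain ⟨n', b', h'⟩ := hg
    exact ⟨n + n', Fin.append b b', fun x => by
      simp [Fin.sum_univ_add, Fin.append_left, Fin.append_right, h, h']⟩
  | smul c f _ hf =>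
    obtain ⟨n, b, h⟩ := hf
    obtain ⟨z, hz⟩ := IsAlgClosed.exists_pow_nat_eq c (n := 3) (by norm_num)
    exact ⟨n, fun i => z • b i, fun x => by
      simp [h, Finset.mul_sum, mul_pow, hz]⟩

theorem mul_mem_cubeSpan {k V : Type*} [Field k] [AddCommGroup V] [Module k V]
    (hk2 : (2 : k) ≠ 0) (hk3 : (3 : k) ≠ 0) (a b c : V →ₗ[k] k) :
    (fun x => a x * b x * c x) ∈ cubeSpan k V := by
  have key : ∀ d : V →ₗ[k] k, (fun x => d x ^ 3) ∈ cubeSpan k V :=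
    fun d => Submodule.subset_span ⟨d, rfl⟩
  have h24 : (24 : k) ≠ 0 := by
    have : (24 : k) = 2 ^ 3 * 3 := by norm_num
    rw [this]
    exact mul_ne_zero (pow_ne_zero _ hk2) hk3
  have h := (cubeSpan k V).smul_mem (24 : k)⁻¹
    ((cubeSpan k V).add_mem
      ((cubeSpan k V).sub_mem ((cubeSpan k V).sub_mem (key (a + b + c)) (key (a + b - c)))
        (key (a - b + c))) (key (a - b - c)))
  convert h using 1
  funext x
  simp only [Pi.smul_apply, Pi.add_apply, Pi.sub_apply, LinearMap.add_apply, LinearMap.sub_apply,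
    smul_eq_mul]
  rw [eq_inv_mul_iff_mul_eq₀ h24]
  ring

theorem rrk_zero_iff {k V : Type*} [Field k] [AddCommGroup V] [Module k V]
    (T : V →ₗ[k] V →ₗ[k] V →ₗ[k] k) :
    rrk k T = 0 ↔ ∀ v, fQuad T v ∈ FinStrength k V := by
  unfold rrk
  rw [Submodule.rank_eq_zero, Submodule.span_eq_bot]
  simp [Submodule.Quotient.mk_eq_zero]

theorem fQuad_apply {k V : Type*} [Field k] [AddCommGroup V] [Module k V]
    (T : V →ₗ[k] V →ₗ[k] V →ₗ[k] k) (v x : V) : fQuad T v x = 3 * T v x x := by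
  simp [fQuad]

/-- Remark 5.4 of the paper. A cubic form is a finite sum of cubes of
linear forms if and only if it has finite strength and residual rank zero. -/
theorem sum_cubes_iff_finite_strength_and_rrk_zero
    {k V : Type*} [Field k] [IsAlgClosed k]
    (hk2 : (2 : k) ≠ 0) (hk3 : (3 : k) ≠ 0)
    [AddCommGroup V] [Module k V]
    (T : V →ₗ[k] V →ₗ[k] V →ₗ[k] k)
    (hT1 : ∀ x y z, T x y z = T y x z) (hT2 : ∀ x y z, T x y z = T x z y) :
    (∃ (n : ℕ) (b : Fin n → V →ₗ[k] k), ∀ x, T x x x = ∑ i, b i x ^ 3) ↔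
      FiniteStrengthCubic k T ∧ rrk k T = 0 := by
  rw [rrk_zero_iff]
  constructor
  · rintro ⟨n, b, h⟩
    refine ⟨⟨n, b, fun i => QuadraticMap.linMulLin (b i) (b i), fun x => ?_⟩, fun v => ?_⟩
    · rw [h]
      refine Finset.sum_congr rfl fun i _ => ?_
      simp only [QuadraticMap.linMulLin_apply]
      ring
    · refine ⟨n, fun i => (3 * b i v) • b i, b, fun x => ?_⟩
      rw [fQuad_apply]
      have e1 := h (v + x)
      have e2 := h (v - x)
      have e3 := h v
      have e4 : ∑ i, b i (v + x) ^ 3 + ∑ i, b i (v - x) ^ 3 =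
          2 * ∑ i, b i v ^ 3 + 2 * ∑ i, ((3 * b i v) • b i) x * b i x := by
        rw [← Finset.sum_add_distrib, Finset.mul_sum, Finset.mul_sum, ← Finset.sum_add_distrib]
        refine Finset.sum_congr rfl fun i _ => ?_
        simp only [map_add, map_sub, LinearMap.smul_apply, smul_eq_mul]
        ring
      rw [← e1, ← e2, ← e3] at e4
      simp only [map_add, map_sub, LinearMap.add_apply, LinearMap.sub_apply] at e4
      have s1 : T x v x = T v x x := hT1 _ _ _
      have s2 : T x x v = T v x x := by rw [hT2, hT1]
      apply mul_left_cancel₀ hk2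
      rw [s1, s2] at e4
      linear_combination e4
  · rintro ⟨⟨n, l, q, h⟩, hf⟩
    apply cubeSpan_exists (f := fun x => T x x x)
    let L : V →ₗ[k] (Fin n → k) := LinearMap.pi l
    obtain ⟨s0, hs0⟩ := L.rangeRestrict.exists_rightInverse_of_surjective L.range_rangeRestrict
    obtain ⟨s, hs⟩ := LinearMap.exists_extend s0
    have hsL : ∀ x, L (s (L x)) = L x := by
      intro x
      have h1 : s (L x) = s0 (L.rangeRestrict x) := by
        rw [← hs]; rfl
      have h2 := LinearMap.congr_fun hs0 (L.rangeRestrict x)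
      rw [h1]
      exact congrArg Subtype.val h2
    let w : V →ₗ[k] V := s ∘ₗ L
    let e : Fin n → V := fun i => s (Pi.single i 1)
    have hw : ∀ x, w x = ∑ i, l i x • e i := by
      intro x
      have : L x = ∑ i, l i x • (Pi.single i (1 : k) : Fin n → k) := by
        rw [pi_eq_sum_univ' (L x)]
        rfl
      change s (L x) = _
      rw [this, map_sum]
      simp [e]
    have hu : ∀ x, T (x - w x) (x - w x) (x - w x) = 0 := by
      intro x
      rw [h]
      refine Finset.sum_eq_zero fun i _ => ?_
      have : l i (x - w x) = 0 := by
        rw [map_sub, sub_eq_zero]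
        exact (congrFun (hsL x) i).symm
      rw [this, zero_mul]
    have hF : ∀ x, T x x x = 3 * T (w x) x x + T (w x) (w x) (w x - (3 : k) • x) := by
      intro x
      have h0 := hu x
      simp only [map_sub, LinearMap.sub_apply, map_smul, smul_eq_mul] at h0 ⊢
      have s1 : T x (w x) x = T (w x) x x := hT1 _ _ _
      have s2 : T x x (w x) = T (w x) x x := by rw [hT2, hT1]
      have s3 : T (w x) x (w x) = T (w x) (w x) x := hT2 _ _ _
      have s4 : T x (w x) (w x) = T (w x) (w x) x := by rw [hT1, hT2]
      rw [s1, s2, s3, s4] at h0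
      linear_combination h0
    choose m a b hab using hf
    have hF2 : (fun x => T x x x) =
        (∑ i, ∑ j, fun x => l i x * a (e i) j x * b (e i) j x) +
        ∑ i, ∑ j, fun x => l i x * l j x *
          ((T (e i) (e j)) ∘ₗ (w - (3 : k) • LinearMap.id)) x := by
      funext x
      simp only [Pi.add_apply, Finset.sum_apply]
      rw [hF x]
      congr 1
      · have : 3 * T (w x) x x = ∑ i, l i x * fQuad T (e i) x := by
          simp only [fQuad_apply]
          rw [hw, map_sum]
          simp only [LinearMap.sum_apply, map_smul, LinearMap.smul_apply, smul_eq_mul,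
            Finset.mul_sum]
          refine Finset.sum_congr rfl fun i _ => ?_
          ring
        rw [this]
        refine Finset.sum_congr rfl fun i _ => ?_
        rw [hab, Finset.mul_sum]
        refine Finset.sum_congr rfl fun j _ => ?_
        ring
      · have : ∀ y, T (w x) (w x) y = ∑ i, ∑ j, l i x * l j x * T (e i) (e j) y := by
          intro y
          rw [hw, map_sum]
          simp only [LinearMap.sum_apply, map_smul, LinearMap.smul_apply, smul_eq_mul,
            Finset.mul_sum, map_sum]
          refine Finset.sum_congr rfl fun i _ => Finset.sum_congr rfl fun j _ => ?_
          rw [hT1 (e i) (e j)]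
          ring
        rw [this]
        rfl
    rw [hF2]
    refine Submodule.add_mem _ ?_ ?_ <;>
    exact Submodule.sum_mem _ fun i _ => Submodule.sum_mem _ fun j _ =>
      mul_mem_cubeSpan hk2 hk3 _ _ _
end

section
/- The cubic space whose underlying vector space is ℕ →₀ k (finitely supported functions) with cubic form F(a) = Σ_{i∈ℕ} a(i)³ (equivalently, with symmetric trilinear form T(a,a',a'') = Σ_{i∈ℕ} a(i)·a'(i)·a''(i)) has residual rank 0 and is non-degenerate (its form does not have finite strength). -/
open scoped BigOperators

/-- The diagonal cubic space on `ℕ →₀ k`, with trilinear form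
`T(a, a', a'') = ∑ i, a i * a' i * a'' i` and cubic form `F(a) = ∑ i, (a i)^3`. -/
noncomputable def TDiag (k : Type*) [Field k] :
    (ℕ →₀ k) →ₗ[k] (ℕ →₀ k) →ₗ[k] (ℕ →₀ k) →ₗ[k] k :=
  triBasis k fun i j l => if i = j ∧ j = l then (1 : k) else 0

theorem TDiag_apply_of_subset (k : Type*) [Field k] (a b c : ℕ →₀ k) (s : Finset ℕ)
    (hs : a.support ⊆ s) : TDiag k a b c = ∑ i ∈ s, a i * b i * c i := by
  have h1 : ∀ i, ∀ b c : ℕ →₀ k,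
      TDiag k (Finsupp.single i 1) b c = b i * c i := by
    intro i b c
    have key : TDiag k (Finsupp.single i 1)
        = (LinearMap.mul k k).compl₁₂ (Finsupp.lapply i) (Finsupp.lapply i) := by
      ext j l
      by_cases hij : i = j <;> by_cases hjl : j = l <;>
        simp [TDiag, triBasis, hij, hjl, Finsupp.single_apply] <;> grind
    rw [key]
    simp
  have ha : a = ∑ i ∈ s, a i • Finsupp.single i (1 : k) := by
    conv_lhs => rw [← Finsupp.sum_single a]
    rw [Finsupp.sum_of_support_subset a hs _ (by simp)]
    simp
  conv_lhs => rw [ha]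
  simp only [map_sum, map_smul, LinearMap.sum_apply, LinearMap.smul_apply, h1, smul_eq_mul,
    mul_assoc]

theorem exists_supported_ker (k : Type*) [Field k] (n : ℕ) (l : Fin n → (ℕ →₀ k) →ₗ[k] k)
    (S : Set ℕ) (hS : S.Infinite) :
    ∃ x : ℕ →₀ k, x ≠ 0 ∧ (∀ i, l i x = 0) ∧ ∀ j, x j ≠ 0 → j ∈ S := by
  let f : Finsupp.supported k k S →ₗ[k] (Fin n → k) :=
    (LinearMap.pi l).comp (Finsupp.supported k k S).subtype
  have hf : ¬ Function.Injective f := by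
    intro hinj
    have h1 : Module.Finite k (Finsupp.supported k k S) := Module.Finite.of_injective f hinj
    have h2 : Module.Finite k (S →₀ k) :=
      Module.Finite.equiv (Finsupp.supportedEquivFinsupp (M := k) (R := k) S)
    have h3 : Finite S := Module.Finite.finite_basis (Finsupp.basisSingleOne (R := k) (ι := S))
    exact hS (Set.toFinite S)
  unfold Function.Injective at hf
  push Not at hf
  obtain ⟨y, z, hyz, hne⟩ := hf
  refine ⟨y.1 - z.1, fun h => hne (Subtype.ext (sub_eq_zero.1 h)), fun i => ?_, fun j hj => ?_⟩
  · have h : l i y.1 = l i z.1 := congrFun hyz i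
    rw [map_sub, h, sub_self]
  · by_contra hjS
    have hy : y.1 j = 0 := by
      by_contra h
      exact hjS ((Finsupp.mem_supported k _).1 y.2 (by simpa using h))
    have hz : z.1 j = 0 := by
      by_contra h
      exact hjS ((Finsupp.mem_supported k _).1 z.2 (by simpa using h))
    exact hj (by rw [Finsupp.sub_apply, hy, hz, sub_self])

/-- Example 1.2 of the paper. The diagonal cubic space
`∑ i, x_i^3` on `ℕ →₀ k` has residual rank `0` and is non-degenerate. -/
theorem TDiag_rrk_zero_and_nondegenerate
    (k : Type*) [Field k] [IsAlgClosed k]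
    (hk2 : (2 : k) ≠ 0) (hk3 : (3 : k) ≠ 0) :
    rrk k (TDiag k) = 0 ∧ ¬ FiniteStrengthCubic k (TDiag k) := by
  constructor
  · have h0 : Submodule.span k (Set.range fun v =>
        Submodule.Quotient.mk (p := FinStrength k (ℕ →₀ k)) (fQuad (TDiag k) v)) = ⊥ := by
      rw [Submodule.span_eq_bot]
      rintro _ ⟨v, rfl⟩
      refine (Submodule.Quotient.mk_eq_zero _).2 ?_
      obtain ⟨N, hN⟩ := v.support.exists_nat_subset_range
      refine ⟨N, fun i => (3 * v i) • Finsupp.lapply (i : ℕ),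
        fun i => Finsupp.lapply (i : ℕ), fun x => ?_⟩
      have h := TDiag_apply_of_subset k v x x _ hN
      have e : fQuad (TDiag k) v x = 3 * TDiag k v x x := by simp [fQuad]
      rw [e, h, ← Fin.sum_univ_eq_sum_range (fun i => v i * x i * x i), Finset.mul_sum]
      refine Finset.sum_congr rfl fun i _ => ?_
      simp
      ring
    unfold rrk
    rw [h0]
    simp
  · rintro ⟨n, l, q, hF⟩
    have hF0 : ∀ x, (∀ i, l i x = 0) → TDiag k x x x = 0 := by
      intro x hx
      rw [hF]
      simp [hx]
    have hT : ∀ x w, (∀ i, l i x = 0) → (∀ i, l i w = 0) → TDiag k x w w = 0 := by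
      intro x w hx hw
      have h1 := hF0 (x + w) (by simp [hx, hw])
      have h2 := hF0 (x - w) (by simp [hx, hw])
      have h3 := hF0 x hx
      have s1 : TDiag k w x w = TDiag k x w w := by
        rw [TDiag_apply_of_subset k _ _ _ (x.support ∪ w.support) Finset.subset_union_left,
          TDiag_apply_of_subset k _ _ _ (x.support ∪ w.support) Finset.subset_union_right]
        exact Finset.sum_congr rfl fun i _ => by ring
      have s2 : TDiag k w w x = TDiag k x w w := by
        rw [TDiag_apply_of_subset k _ _ _ (x.support ∪ w.support) Finset.subset_union_left,
          TDiag_apply_of_subset k _ _ _ (x.support ∪ w.support) Finset.subset_union_right]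
        exact Finset.sum_congr rfl fun i _ => by ring
      simp only [map_add, map_sub, LinearMap.add_apply, LinearMap.sub_apply, s1, s2, h3] at h1 h2
      have h6 : (2 * 3 : k) * TDiag k x w w = 0 := by linear_combination h1 + h2
      exact (mul_eq_zero.1 h6).resolve_left (mul_ne_zero hk2 hk3)
    let P : Set ℕ := {p | ∃ w : ℕ →₀ k, (∀ i, l i w = 0) ∧ w p ≠ 0 ∧ ∀ j < p, w j = 0}
    have hP : P.Infinite := by
      refine Set.infinite_of_forall_exists_gt fun N => ?_
      obtain ⟨w, hw0, hw, hwS⟩ := exists_supported_ker k n l (Set.Ioi N) (Set.Ioi_infinite N)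
      have hex : ∃ p, w p ≠ 0 := by
        by_contra! h
        exact hw0 (Finsupp.ext h)
      classical
      refine ⟨Nat.find hex, ⟨w, hw, Nat.find_spec hex, fun j hj => ?_⟩,
        hwS _ (Nat.find_spec hex)⟩
      simpa using Nat.find_min hex hj
    obtain ⟨x, hx0, hx, hxP⟩ := exists_supported_ker k n l P hP
    have hne : x.support.Nonempty := Finsupp.support_nonempty_iff.2 hx0
    have hmem := x.support.max'_mem hne
    have hle : ∀ j ∈ x.support, j ≤ x.support.max' hne :=
      fun j hj => x.support.le_max' j hj
    generalize x.support.max' hne = p at hmem hle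
    obtain ⟨w, hw, hwp, hwlt⟩ := hxP p (by simpa using hmem)
    have h := hT x w hx hw
    rw [TDiag_apply_of_subset k _ _ _ _ subset_rfl, Finset.sum_eq_single p] at h
    · have hxp : x p ≠ 0 := by simpa using hmem
      exact mul_ne_zero (mul_ne_zero hxp hwp) hwp h
    · intro j hj hjp
      rw [hwlt j (lt_of_le_of_ne (hle j hj) hjp)]
      simp
    · intro hp
      exact absurd hmem hp
end

section
/- The cubic space V(∞) has infinite residual rank; that is, the image of the linear map v ↦ class of f_v from V(∞) to P̄₂(V(∞)) is an infinite-dimensional subspace. -/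
open scoped BigOperators

lemma TInf_aux (k : Type*) [Field k] (i i0 j : ℕ) (b : ℕ →₀ k) :
    TInf k (Finsupp.single i 1, 0) (0, b.mapDomain (fun j => (i0, j)))
      (0, Finsupp.single (i0, j) 1) = if i = i0 then b j else 0 := by
  have he1 : eInf k (Finsupp.single i 1, 0) = Finsupp.single (Sum.inl i) 1 := by
    ext x; cases x <;> simp [eInf, Finsupp.single_apply]
  have he2 : ∀ (p : ℕ × ℕ) (c : k), eInf k (0, Finsupp.single p c) =
      Finsupp.single (Sum.inr p) c := by
    intro p c
    ext x; cases x <;> simp [eInf, Finsupp.single_apply]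
  induction b using Finsupp.induction_linear with
  | zero =>
    have h0 : ((0 : ℕ →₀ k), (0 : (ℕ × ℕ) →₀ k)) = 0 := rfl
    simp [h0]
  | add f g hf hg =>
    rw [Finsupp.mapDomain_add]
    have : ((0 : ℕ →₀ k), f.mapDomain (fun j => (i0, j)) + g.mapDomain (fun j => (i0, j)))
      = (0, f.mapDomain (fun j => (i0, j))) + (0, g.mapDomain (fun j => (i0, j))) := by simp
    rw [this, map_add, LinearMap.add_apply, hf, hg]
    split_ifs <;> simp
  | single a c =>
    rw [Finsupp.mapDomain_single]
    simp only [TInf, comp3, LinearMap.coe_mk, AddHom.coe_mk, LinearMap.compl₁₂_apply, he1, he2]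
    simp only [triBasis, cInf, gInf]
    by_cases h : i = i0 <;> by_cases h' : a = j <;>
      simp [h, h', Finsupp.single_apply, eq_comm] <;> grind

lemma TInf_symm_aux (k : Type*) [Field k] (i i0 j : ℕ) (b : ℕ →₀ k) :
    TInf k (Finsupp.single i 1, 0) 
      (0, Finsupp.single (i0, j) 1) (0, b.mapDomain (fun j => (i0, j))) =
      if i = i0 then b j else 0 := by
  have he1 : eInf k (Finsupp.single i 1, 0) = Finsupp.single (Sum.inl i) 1 := by
    ext x; cases x <;> simp [eInf, Finsupp.single_apply]
  have he2 : ∀ (p : ℕ × ℕ) (c : k), eInf k (0, Finsupp.single p c) =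
      Finsupp.single (Sum.inr p) c := by
    intro p c
    ext x; cases x <;> simp [eInf, Finsupp.single_apply]
  induction b using Finsupp.induction_linear with
  | zero =>
    have h0 : ((0 : ℕ →₀ k), (0 : (ℕ × ℕ) →₀ k)) = 0 := rfl
    simp [h0]
  | add f g hf hg =>
    rw [Finsupp.mapDomain_add]
    have : ((0 : ℕ →₀ k), f.mapDomain (fun j => (i0, j)) + g.mapDomain (fun j => (i0, j)))
      = (0, f.mapDomain (fun j => (i0, j))) + (0, g.mapDomain (fun j => (i0, j))) := by simp
    rw [this, map_add, hf, hg]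
    split_ifs <;> simp
  | single a c =>
    rw [Finsupp.mapDomain_single]
    simp only [TInf, comp3, LinearMap.coe_mk, AddHom.coe_mk, LinearMap.compl₁₂_apply, he1, he2]
    simp only [triBasis, cInf, gInf]
    by_cases h : i = i0 <;> by_cases h' : a = j <;>
      simp [h, h', Finsupp.single_apply, eq_comm] <;> grind

lemma exists_ker_aux (k : Type*) [Field k] (n : ℕ) (L : (ℕ →₀ k) →ₗ[k] (Fin n → k) × (Fin n → k)) :
    ∃ b : ℕ →₀ k, b ≠ 0 ∧ L b = 0 := by
  by_contra! h
  have hinj : Function.Injective L := by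
    rw [← LinearMap.ker_eq_bot, LinearMap.ker_eq_bot']
    intro m hm
    by_contra h0
    exact h m h0 hm
  have : Module.Finite k (ℕ →₀ k) := Module.Finite.of_injective L hinj
  have h2 := Module.rank_lt_aleph0 k (ℕ →₀ k)
  simp at h2

lemma rrk_aux (k : Type*) {V : Type*} [Field k] [AddCommGroup V] [Module k V]
    (T : V →ₗ[k] V →ₗ[k] V →ₗ[k] k) (w : ℕ → V)
    (hw : ∀ (s : Finset ℕ) (c : ℕ → k), ∑ i ∈ s, c i • fQuad T (w i) ∈ FinStrength k V →
      ∀ i ∈ s, c i = 0) : Cardinal.aleph0 ≤ rrk k T := by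
  have hli : LinearIndependent k (fun i : ℕ =>
      Submodule.Quotient.mk (p := FinStrength k V) (fQuad T (w i))) := by
    rw [linearIndependent_iff']
    intro s c hc
    apply hw s c
    refine (Submodule.Quotient.mk_eq_zero (R := k) (M := QuadraticForm k V)
      (FinStrength k V)).1 ?_
    refine Eq.trans ?_ hc
    exact map_sum (Submodule.mkQ (R := k) (M := QuadraticForm k V) (FinStrength k V)) _ _
  unfold rrk
  have hli2 : LinearIndependent k (fun i : ℕ =>
      (⟨Submodule.Quotient.mk (p := FinStrength k V) (fQuad T (w i)),
        Submodule.subset_span ⟨_, rfl⟩⟩ :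
        ↥(Submodule.span k (Set.range fun v =>
          Submodule.Quotient.mk (p := FinStrength k V) (fQuad T v))))) :=
    LinearIndependent.of_comp (Submodule.subtype _) hli
  exact hli2.aleph0_le_rank

/-- Example 1.3 of the paper. The cubic space `V(∞)` has infinite
residual rank. -/
theorem TInf_rrk_infinite
    (k : Type*) [Field k] [IsAlgClosed k]
    (hk2 : (2 : k) ≠ 0) (hk3 : (3 : k) ≠ 0) :
    Cardinal.aleph0 ≤ rrk k (TInf k) := by
  apply rrk_aux k (TInf k) (fun i => (Finsupp.single i 1, 0))
  · intro s c hmem i0 hi0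
    obtain ⟨n, l, m, h⟩ := hmem
    let ι : (ℕ →₀ k) →ₗ[k] VInf k :=
      (LinearMap.inr k (ℕ →₀ k) ((ℕ × ℕ) →₀ k)).comp
        (Finsupp.lmapDomain k k (fun j : ℕ => (i0, j)))
    obtain ⟨b, hb, hL⟩ := exists_ker_aux k n
      (((LinearMap.pi l).prod (LinearMap.pi m)).comp ι)
    obtain ⟨j, hj⟩ := Finsupp.ne_iff.mp hb
    have hl : ∀ t, l t (ι b) = 0 := fun t => congrFun (congrArg Prod.fst hL) t
    have hm : ∀ t, m t (ι b) = 0 := fun t => congrFun (congrArg Prod.snd hL) t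
    have hιb : ι b = (0, b.mapDomain (fun j => (i0, j))) := rfl
    let y : VInf k := (0, Finsupp.single (i0, j) 1)
    have h1 := h (ι b + y)
    have h2 := h (ι b)
    have h3 := h y
    simp only [map_add, hl, hm, zero_add, ← h3] at h1
    simp only [hl, hm, mul_zero, Finset.sum_const_zero] at h2
    have key : ∑ i ∈ s, c i * (3 * (2 * if i = i0 then b j else 0)) = 0 := by
      have : ∀ i, c i * (3 * (2 * if i = i0 then b j else 0)) =
          (c i • fQuad (TInf k) (Finsupp.single i 1, 0)) (ι b + y)
          - (c i • fQuad (TInf k) (Finsupp.single i 1, 0)) (ι b)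
          - (c i • fQuad (TInf k) (Finsupp.single i 1, 0)) y := by
        intro i
        have e1 := TInf_aux k i i0 j b
        have e2 := TInf_symm_aux k i i0 j b
        rw [← hιb] at e1 e2
        simp only [smul_apply, fQuad, LinearMap.BilinMap.toQuadraticMap_apply,
          LinearMap.smul_apply, map_add, LinearMap.add_apply, smul_eq_mul]
        linear_combination (-3 * c i) * e1 - 3 * c i * e2
      rw [Finset.sum_congr rfl (fun i _ => this i), Finset.sum_sub_distrib,
        Finset.sum_sub_distrib]
      simp only [sum_apply] at h1 h2
      rw [h1, h2]; ring
    have hz : c i0 * (3 * (2 * b j)) = 0 := by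
      rw [← key, Finset.sum_eq_single i0] <;> simp_all
    have hj' : b j ≠ 0 := by simpa using hj
    simpa [hk2, hk3, hj'] using hz
end
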